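/- arXiv:1910.12509 — 3 statements merged into one kernel-verified Lean document; each statement's English description precedes it below -/
import Mathlib

section
/- If λ' is a refinement of λ (so k_{λ'} = k_λ), then every λ-choosable finite simple graph is λ'-choosable. -/
open SimpleGraph

/-- `G` has a proper colouring from the lists `L`. -/
def ListColourable {V : Type*} (G : SimpleGraph V) (L : V → Finset ℕ) : Prop :=
  ∃ f : V → ℕ, (∀ v, f v ∈ L v) ∧ ∀ ⦃u w⦄, G.Adj u w → f u ≠ f w

/-- `L` is a `lam`-list assignment: the elements `k_1, …, k_q` of the multiset `lam`
can be enumerated by a list `l`, and there are pairwise disjoint colour sets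
`C 1, …, C q` such that `|L v ∩ C i| ≥ k_i` for every vertex `v` and every `i`. -/
def IsLamAssignment {V : Type*} (lam : Multiset ℕ) (L : V → Finset ℕ) : Prop :=
  ∃ (l : List ℕ) (C : Fin l.length → Finset ℕ),
    (l : Multiset ℕ) = lam ∧
    (∀ i j, i ≠ j → Disjoint (C i) (C j)) ∧
    ∀ (v : V) (i : Fin l.length), l.get i ≤ ((L v) ∩ C i).card

/-- `G` is `lam`-choosable. -/
def LamChoosable {V : Type*} (G : SimpleGraph V) (lam : Multiset ℕ) : Prop :=
  ∀ L : V → Finset ℕ, IsLamAssignment lam L → ListColourable G L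

/-- `lam'` is a refinement of `lam`: it is obtained by replacing each element of `lam`
by a multiset of positive integers summing to that element. -/
def IsRefinement (lam' lam : Multiset ℕ) : Prop :=
  ∃ p : Multiset (ℕ × Multiset ℕ),
    p.map Prod.fst = lam ∧
    (p.map Prod.snd).join = lam' ∧
    ∀ pr ∈ p, (pr.2).sum = pr.1 ∧ ∀ x ∈ pr.2, 0 < x

/-- A `lam`-list assignment is witnessed by a list of pairs `(k, C)`. -/
theorem isLamAssignment_iff_exists_list {V : Type*} {lam : Multiset ℕ} {L : V → Finset ℕ} :
    IsLamAssignment lam L ↔ ∃ m : List (ℕ × Finset ℕ),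
      (m : Multiset (ℕ × Finset ℕ)).map Prod.fst = lam ∧
      m.Pairwise (fun x y => Disjoint x.2 y.2) ∧
      ∀ x ∈ m, ∀ v, x.1 ≤ (L v ∩ x.2).card := by
  constructor
  · rintro ⟨l, C, hl, hC, hcard⟩
    refine ⟨List.ofFn fun i => (l.get i, C i), ?_, ?_, ?_⟩
    · rw [Multiset.map_coe, List.map_ofFn, ← hl]
      exact congrArg _ (List.ofFn_get l)
    · exact List.pairwise_ofFn.2 fun i j hij => hC i j hij.ne
    · intro x hx v
      obtain ⟨i, rfl⟩ := (List.mem_ofFn' _ _).1 hx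
      exact hcard v i
  · rintro ⟨m, hm, hdisj, hcard⟩
    refine ⟨m.map Prod.fst, fun i => (m.get (i.cast (by simp))).2, by simpa using hm, ?_, ?_⟩
    · intro i j hij
      rw [List.pairwise_iff_get] at hdisj
      rcases lt_or_gt_of_ne hij with h | h
      · exact hdisj (i.cast (by simp)) (j.cast (by simp)) h
      · exact (hdisj (j.cast (by simp)) (i.cast (by simp)) h).symm
    · intro v i
      simpa using hcard (m.get (i.cast (by simp))) (List.get_mem _ _) v

theorem IsLamAssignment.zero_cons {V : Type*} {s : Multiset ℕ} {L : V → Finset ℕ}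
    (h : IsLamAssignment s L) : IsLamAssignment (0 ::ₘ s) L := by
  rw [isLamAssignment_iff_exists_list] at h ⊢
  obtain ⟨m, rfl, hdisj, hcard⟩ := h
  exact ⟨(0, ∅) :: m, by simp, by simpa using hdisj, by simpa using hcard⟩

/-- Two parts of `lam` can be merged by taking the union of their colour sets. -/
theorem IsLamAssignment.merge {V : Type*} {a b : ℕ} {s : Multiset ℕ} {L : V → Finset ℕ}
    (h : IsLamAssignment (a ::ₘ b ::ₘ s) L) : IsLamAssignment ((a + b) ::ₘ s) L := by
  rw [isLamAssignment_iff_exists_list] at h ⊢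
  obtain ⟨m, hm, hdisj, hcard⟩ := h
  obtain ⟨x, hx, rfl, hmx⟩ := (Multiset.map_eq_cons _ _ _ _).2 hm
  obtain ⟨y, hy, rfl, hmxy⟩ := (Multiset.map_eq_cons _ _ _ _).2 hmx
  obtain ⟨t, ht⟩ := Quot.exists_rep (((m : Multiset (ℕ × Finset ℕ)).erase x).erase y)
  have hperm : m.Perm (x :: y :: t) := by
    rw [← Multiset.coe_eq_coe, ← Multiset.cons_coe, ← Multiset.cons_coe]
    change _ = x ::ₘ y ::ₘ Quot.mk _ t
    rw [ht, Multiset.cons_erase hy, Multiset.cons_erase hx]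
  rw [← ht, Multiset.quot_mk_to_coe''] at hmxy
  rw [hperm.pairwise_iff fun h => h.symm] at hdisj
  simp only [hperm.mem_iff, List.pairwise_cons, List.forall_mem_cons] at hdisj hcard
  obtain ⟨⟨hxy, hxt⟩, hyt, htt⟩ := hdisj
  obtain ⟨hcx, hcy, hct⟩ := hcard
  refine ⟨(x.1 + y.1, x.2 ∪ y.2) :: t, by simp [← hmxy], ?_, ?_⟩
  · refine List.pairwise_cons.2 ⟨fun z hz => ?_, htt⟩
    exact Finset.disjoint_union_left.2 ⟨hxt z hz, hyt z hz⟩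
  · refine List.forall_mem_cons.2 ⟨fun v => ?_, hct⟩
    rw [Finset.inter_union_distrib_left, Finset.card_union_of_disjoint
      (hxy.mono Finset.inter_subset_right Finset.inter_subset_right)]
    exact add_le_add (hcx v) (hcy v)

theorem IsLamAssignment.sum_cons {V : Type*} {A s : Multiset ℕ} {L : V → Finset ℕ}
    (h : IsLamAssignment (A + s) L) : IsLamAssignment (A.sum ::ₘ s) L := by
  induction A using Multiset.induction_on generalizing s with
  | empty => simpa using h.zero_cons
  | cons a A ih =>
    rw [Multiset.cons_add, ← Multiset.add_cons] at h
    rw [Multiset.sum_cons, add_comm]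
    exact (ih h).merge

theorem IsLamAssignment.map_fst_add {V : Type*} {p : Multiset (ℕ × Multiset ℕ)}
    {s : Multiset ℕ} {L : V → Finset ℕ} (hp : ∀ pr ∈ p, pr.2.sum = pr.1)
    (h : IsLamAssignment ((p.map Prod.snd).join + s) L) :
    IsLamAssignment (p.map Prod.fst + s) L := by
  induction p using Multiset.induction_on generalizing s with
  | empty => simpa using h
  | cons a p ih =>
    rw [Multiset.map_cons, Multiset.join_cons, add_assoc, add_left_comm] at h
    have h' := ih (fun pr hpr => hp pr (Multiset.mem_cons_of_mem hpr)) h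
    rw [add_left_comm] at h'
    rw [Multiset.map_cons, Multiset.cons_add, ← hp a (Multiset.mem_cons_self a p)]
    exact h'.sum_cons

/-- An assignment for a refinement of `lam` is an assignment for `lam`. -/
theorem IsLamAssignment.of_isRefinement {V : Type*} {lam lam' : Multiset ℕ} {L : V → Finset ℕ}
    (href : IsRefinement lam' lam) (h : IsLamAssignment lam' L) : IsLamAssignment lam L := by
  obtain ⟨p, rfl, rfl, hp⟩ := href
  have h' := IsLamAssignment.map_fst_add (s := 0) (fun pr hpr => (hp pr hpr).1) (by simpa using h)
  simpa using h'

theorem refinement_choosable {V : Type*} [Fintype V] (G : SimpleGraph V)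
    (lam lam' : Multiset ℕ) (hpos : ∀ x ∈ lam, 0 < x)
    (href : IsRefinement lam' lam) (h : LamChoosable G lam) :
    LamChoosable G lam' :=
  fun L hL => h L (hL.of_isRefinement href)
end

section
/- Let λ be a multiset of positive integers with sum k_λ, and let 1_λ be the multiplicity of 1 in λ. Then every finite simple graph G with chromatic number equal to k_λ and at most 2k_λ + 1_λ + 1 vertices is λ-choosable. -/
open SimpleGraph

namespace Ohba

open Finset

/-- A set of a family indexed by at most as many indices as every member has elements
has distinct representatives. -/
theorem exists_injOn_of_card_le {ι α : Type*} [DecidableEq ι] [DecidableEq α] [Nonempty α]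
    (s : Finset ι) (t : ι → Finset α) (h : ∀ i ∈ s, s.card ≤ (t i).card) :
    ∃ e : ι → α, Set.InjOn e s ∧ ∀ i ∈ s, e i ∈ t i := by
  induction s using Finset.induction_on with
  | empty => exact ⟨fun _ => Classical.arbitrary α, by simp, by simp⟩
  | insert a s ha ih =>
    rw [Finset.card_insert_of_notMem ha] at h
    obtain ⟨e, he, het⟩ := ih fun i hi => (Nat.le_succ _).trans (h i (Finset.mem_insert_of_mem hi))
    obtain ⟨x, hx, hxe⟩ : ∃ x ∈ t a, x ∉ s.image e := by
      apply Finset.exists_mem_notMem_of_card_lt_card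
      exact lt_of_le_of_lt Finset.card_image_le (h a (Finset.mem_insert_self _ _))
    have hne : ∀ i ∈ s, i ≠ a := fun i hi hia => ha (hia ▸ hi)
    have hex : ∀ i ∈ s, e i ≠ x := fun i hi hix =>
      hxe (hix ▸ Finset.mem_image_of_mem e hi)
    refine ⟨Function.update e a x, ?_, ?_⟩
    · intro i hi j hj hij
      simp only [Finset.coe_insert, Set.mem_insert_iff, Finset.mem_coe] at hi hj
      rcases hi with rfl | hi <;> rcases hj with rfl | hj
      · rfl
      · rw [Function.update_self, Function.update_of_ne (hne j hj)] at hij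
        exact absurd hij.symm (hex j hj)
      · rw [Function.update_self, Function.update_of_ne (hne i hi)] at hij
        exact absurd hij (hex i hi)
      · rw [Function.update_of_ne (hne i hi), Function.update_of_ne (hne j hj)] at hij
        exact he hi hj hij
    · intro i hi
      rcases Finset.mem_insert.1 hi with rfl | hi
      · simpa using hx
      · rw [Function.update_of_ne (hne i hi)]
        exact het i hi

/-- A nonempty set of configurations with a bounded measure contains one of maximal measure. -/
theorem exists_maximal_of_le {α : Type*} {p : α → Prop} {m : α → ℕ} (B : ℕ)
    (hne : ∃ x, p x) (hB : ∀ x, p x → m x ≤ B) : ∃ x, p x ∧ ∀ y, p y → m y ≤ m x := by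
  classical
  obtain ⟨x, hx, hmin⟩ := exists_minimalFor_of_wellFoundedLT p (fun x => B - m x) hne
  refine ⟨x, hx, fun y hy => ?_⟩
  by_contra hlt
  have := hB x hx
  have := hB y hy
  have := hmin hy (by simp only; omega)
  simp only at this
  omega

/-- Hall's theorem with deficiency: outside a set of maximal deficiency, distinct
representatives exist that avoid the neighbourhood of this set. -/
theorem exists_max_deficiency {ι α : Type*} [DecidableEq ι] [DecidableEq α] [Nonempty α]
    (s : Finset ι) (t : ι → Finset α) :
    ∃ S ⊆ s, (∀ S' ⊆ s, S'.card + (S.biUnion t).card ≤ S.card + (S'.biUnion t).card) ∧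
      ∃ e : ι → α, (∀ i ∈ s, i ∉ S → ∀ j ∈ s, j ∉ S → e i = e j → i = j) ∧
        ∀ i ∈ s, i ∉ S → e i ∈ t i ∧ e i ∉ S.biUnion t := by
  obtain ⟨S, hSs, hS⟩ := Finset.exists_max_image s.powerset
    (fun S => (S.card : ℤ) - (S.biUnion t).card) ⟨∅, Finset.empty_mem_powerset s⟩
  have hS' : ∀ S' ⊆ s, S'.card + (S.biUnion t).card ≤ S.card + (S'.biUnion t).card := by
    intro S' hS's
    have := hS S' (Finset.mem_powerset.2 hS's)
    omega
  rw [Finset.mem_powerset] at hSs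
  refine ⟨S, hSs, hS', ?_⟩
  obtain ⟨e, he, het⟩ := (Finset.all_card_le_biUnion_card_iff_exists_injective
    (fun i : {i // i ∈ s ∧ i ∉ S} => t i.1 \ S.biUnion t)).1 (by
      intro X
      have hdisj : Disjoint S (X.map (Function.Embedding.subtype _)) := by
        rw [Finset.disjoint_left]
        intro i hi hiX
        obtain ⟨x, -, rfl⟩ := Finset.mem_map.1 hiX
        exact x.2.2 hi
      have h1 := hS' (S ∪ X.map (Function.Embedding.subtype _)) (Finset.union_subset hSs (by
        intro i hiX
        obtain ⟨x, -, rfl⟩ := Finset.mem_map.1 hiX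
        exact x.2.1))
      rw [Finset.card_union_of_disjoint hdisj, Finset.card_map] at h1
      have h2 : (S ∪ X.map (Function.Embedding.subtype _)).biUnion t ⊆
          S.biUnion t ∪ X.biUnion (fun i => t i.1 \ S.biUnion t) := by
        intro c hc
        by_cases hcS : c ∈ S.biUnion t
        · exact Finset.mem_union_left _ hcS
        · obtain ⟨i, hi, hci⟩ := Finset.mem_biUnion.1 hc
          rcases Finset.mem_union.1 hi with hi | hi
          · exact absurd (Finset.mem_biUnion.2 ⟨i, hi, hci⟩) hcS
          · obtain ⟨x, hx, rfl⟩ := Finset.mem_map.1 hi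
            exact Finset.mem_union_right _
              (Finset.mem_biUnion.2 ⟨x, hx, Finset.mem_sdiff.2 ⟨hci, hcS⟩⟩)
      have h3 := (Finset.card_le_card h2).trans (Finset.card_union_le _ _)
      omega)
  refine ⟨fun i => if h : i ∈ s ∧ i ∉ S then e ⟨i, h⟩ else Classical.arbitrary α, ?_, ?_⟩
  · intro i his hi j hjs hj hij
    simp only [his, hjs, hi, hj, not_false_eq_true, and_self, dite_true] at hij
    exact congrArg Subtype.val (he hij)
  · intro i his hi
    simp only [his, hi, not_false_eq_true, and_self, dite_true]
    exact Finset.mem_sdiff.1 (het ⟨i, his, hi⟩)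

/-- A minimal counterexample to Ohba's conjecture for complete `k`-partite graphs, where the parts
are the fibres of `π`. -/
structure OhbaCounterexample {V : Type*} [Fintype V] [DecidableEq V] {k : ℕ} (π : V → Fin k)
    (L : V → Finset ℕ) : Prop where
  surj : Function.Surjective π
  card_le : Fintype.card V ≤ 2 * k + 1
  le_card : ∀ v, k ≤ (L v).card
  not_colourable : ∀ f : V → ℕ, (∀ v, f v ∈ L v) → (∀ u w, f u = f w → π u = π w) → False
  ih : ∀ (Q : Finset V) (L' : V → Finset ℕ) (k' : ℕ), Q ≠ univ → (Q.image π).card ≤ k' →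
    Q.card ≤ 2 * k' + 1 → (∀ v ∈ Q, k' ≤ (L' v).card) →
    ∃ g : V → ℕ, (∀ v ∈ Q, g v ∈ L' v) ∧ ∀ u ∈ Q, ∀ w ∈ Q, g u = g w → π u = π w

/-- The set of all colours that occur in the lists. -/
def pot {V : Type*} [Fintype V] (L : V → Finset ℕ) : Finset ℕ := univ.biUnion L

/-- The part with index `i`. -/
def part {V : Type*} [Fintype V] {k : ℕ} (π : V → Fin k) (i : Fin k) : Finset V :=
  univ.filter fun v => π v = i

/-- The vertices whose list contains the colour `c`. -/
def having {V : Type*} [Fintype V] (L : V → Finset ℕ) (c : ℕ) : Finset V :=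
  univ.filter fun v => c ∈ L v

/-- The vertices that form a part on their own. -/
def singles {V : Type*} [Fintype V] [DecidableEq V] {k : ℕ} (π : V → Fin k) : Finset V :=
  univ.filter fun v => (part π (π v)).card = 1

/-- The indices of the parts with at least two vertices. -/
def bigParts {V : Type*} [Fintype V] {k : ℕ} (π : V → Fin k) : Finset (Fin k) :=
  univ.filter fun i => 2 ≤ (part π i).card

theorem sum_card_filter_mem {V : Type*} (L : V → Finset ℕ) (s : Finset V) (D : Finset ℕ) :
    ∑ c ∈ D, (s.filter fun v => c ∈ L v).card = ∑ v ∈ s, (L v ∩ D).card := by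
  simp only [card_filter]
  rw [sum_comm]
  refine sum_congr rfl fun v _ => ?_
  rw [← card_filter, filter_mem_eq_inter, inter_comm]

section

variable {V : Type*} [Fintype V] {k : ℕ} {π : V → Fin k} {L : V → Finset ℕ}

theorem mem_part {i : Fin k} {v : V} : v ∈ part π i ↔ π v = i := by simp [part]

theorem mem_having {c : ℕ} {v : V} : v ∈ having L c ↔ c ∈ L v := by simp [having]

theorem subset_pot (v : V) : L v ⊆ pot L := subset_biUnion_of_mem L (mem_univ v)

theorem biUnion_subset_pot (S : Finset V) : S.biUnion L ⊆ pot L :=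
  biUnion_subset_biUnion_of_subset_left L (subset_univ S)

theorem sum_card_part (π : V → Fin k) : ∑ i, (part π i).card = Fintype.card V :=
  (card_eq_sum_card_fiberwise (f := π) (s := univ) (t := univ) (by simp)).symm

theorem mem_bigParts {i : Fin k} : i ∈ bigParts π ↔ 2 ≤ (part π i).card := by simp [bigParts]

end

namespace OhbaCounterexample

variable {V : Type*} [Fintype V] [DecidableEq V] {k : ℕ} {π : V → Fin k} {L : V → Finset ℕ}

theorem card_part_pos (h : OhbaCounterexample π L) (i : Fin k) : 1 ≤ (part π i).card := by
  obtain ⟨v, hv⟩ := h.surj i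
  exact card_pos.2 ⟨v, mem_part.2 hv⟩

theorem card_sub_le_card_sub (h : OhbaCounterexample π L) (S : Finset V) :
    S.card + (pot L).card ≤ Fintype.card V + (S.biUnion L).card := by
  obtain ⟨S, -, hS, e, he, het⟩ := exists_max_deficiency univ L
  have hSuniv : S = univ := by
    by_contra hne
    obtain ⟨g, hg, hgp⟩ := h.ih S L k hne (by simpa using card_le_univ (S.image π))
      ((card_le_univ S).trans h.card_le) (fun v _ => h.le_card v)
    refine h.not_colourable (fun v => if v ∈ S then g v else e v) (fun v => ?_) (fun u w huw => ?_)
    · by_cases hv : v ∈ S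
      · simpa [hv] using hg v hv
      · simpa [hv] using (het v (mem_univ v) hv).1
    · by_cases hu : u ∈ S <;> by_cases hw : w ∈ S <;> simp only [hu, hw, if_true, if_false] at huw
      · exact hgp u hu w hw huw
      · exact absurd (mem_biUnion.2 ⟨u, hu, huw ▸ hg u hu⟩) (het w (mem_univ w) hw).2
      · exact absurd (mem_biUnion.2 ⟨w, hw, huw ▸ hg w hw⟩) (het u (mem_univ u) hu).2
      · rw [he u (mem_univ u) hu w (mem_univ w) hw huw]
  subst hSuniv
  simpa [pot] using hS _ (subset_univ _)

theorem card_pot_lt (h : OhbaCounterexample π L) : (pot L).card < Fintype.card V := by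
  by_contra hlt
  obtain ⟨f, hf, hfL⟩ := (all_card_le_biUnion_card_iff_exists_injective L).1 (fun S => by
    have := h.card_sub_le_card_sub S
    omega)
  exact h.not_colourable f hfL fun u w huw => by rw [hf huw]

theorem exists_pot_matching (h : OhbaCounterexample π L) :
    ∃ μ : ℕ → V, (∀ c ∈ pot L, ∀ d ∈ pot L, μ c = μ d → c = d) ∧ ∀ c ∈ pot L, c ∈ L (μ c) := by
  obtain ⟨μ, hμ, hμL⟩ := (all_card_le_biUnion_card_iff_exists_injective
    (fun c : pot L => having L c)).1 (fun X => by
      have h1 := h.card_sub_le_card_sub (X.biUnion fun c : pot L => having L c)ᶜ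
      have h2 := card_compl_add_card (X.biUnion fun c : pot L => having L c)
      have h3 : (X.biUnion fun c : pot L => having L c)ᶜ.biUnion L ⊆
          pot L \ X.map (Function.Embedding.subtype _) := by
        intro c hc
        obtain ⟨v, hv, hcv⟩ := mem_biUnion.1 hc
        refine mem_sdiff.2 ⟨subset_pot v hcv, fun hcX => ?_⟩
        obtain ⟨x, hx, rfl⟩ := mem_map.1 hcX
        exact mem_compl.1 hv (mem_biUnion.2 ⟨x, hx, mem_having.2 hcv⟩)
      have h4 : X.map (Function.Embedding.subtype _) ⊆ pot L := by
        intro c hc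
        obtain ⟨x, -, rfl⟩ := mem_map.1 hc
        exact x.2
      have h5 := card_le_card h3
      rw [card_sdiff_of_subset h4, card_map] at h5
      have h6 := card_le_card h4
      rw [card_map] at h6
      omega)
  have hne : Nonempty V := Fintype.card_pos_iff.1 (by have := h.card_pot_lt; omega)
  refine ⟨fun c => if hc : c ∈ pot L then μ ⟨c, hc⟩ else Classical.arbitrary V, ?_, ?_⟩
  · intro c hc d hd hcd
    simp only [hc, hd, dite_true] at hcd
    exact congrArg Subtype.val (hμ hcd)
  · intro c hc
    simp only [hc, dite_true]
    exact mem_having.1 (hμL ⟨c, hc⟩)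

theorem exists_notMem (h : OhbaCounterexample π L) {i : Fin k}
    (hi : 2 ≤ (part π i).card ∨ Fintype.card V ≤ 2 * k) (c : ℕ) : ∃ v, π v = i ∧ c ∉ L v := by
  by_contra! hc
  have hpos := h.card_part_pos i
  have hk : 0 < k := i.pos
  have hcard := card_compl_add_card (part π i)
  have hle := h.card_le
  obtain ⟨g, hg, hgp⟩ := h.ih (part π i)ᶜ (fun v => L v \ {c}) (k - 1)
    (by
      intro hu
      rw [hu, card_univ] at hcard
      omega)
    (by
      have : (part π i)ᶜ.image π ⊆ univ.erase i := by
        intro j hj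
        obtain ⟨v, hv, rfl⟩ := mem_image.1 hj
        exact mem_erase.2 ⟨fun hvi => mem_compl.1 hv (mem_part.2 hvi), mem_univ _⟩
      simpa using card_le_card this)
    (by omega)
    (fun v _ => by
      have := h.le_card v
      have := le_card_sdiff {c} (L v)
      rw [card_singleton] at this
      omega)
  have hg' : ∀ v, π v ≠ i → g v ∈ L v ∧ g v ≠ c := fun v hv => by
    simpa using hg v (by simpa [mem_part] using hv)
  refine h.not_colourable (fun v => if π v = i then c else g v) (fun v => ?_) (fun u w huw => ?_)
  · by_cases hv : π v = i
    · simpa [hv] using hc v hv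
    · simpa [hv] using (hg' v hv).1
  · by_cases hu : π u = i <;> by_cases hw : π w = i <;> simp only [hu, hw, if_true, if_false] at huw
    · rw [hu, hw]
    · exact absurd huw.symm (hg' w hw).2
    · exact absurd huw (hg' u hu).2
    · exact hgp u (by simpa [mem_part] using hu) w (by simpa [mem_part] using hw) huw

end OhbaCounterexample

namespace OhbaCounterexample

variable {V : Type*} [Fintype V] [DecidableEq V] {k : ℕ} {π : V → Fin k} {L : V → Finset ℕ}

theorem two_mul_le_card_biUnion (h : OhbaCounterexample π L) {i : Fin k}
    (hi : (part π i).card = 2) : 2 * k ≤ ((part π i).biUnion L).card := by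
  obtain ⟨u, w, -, hp⟩ := card_eq_two.1 hi
  have hdisj : Disjoint (L u) (L w) := by
    rw [Finset.disjoint_left]
    intro c hu hw
    obtain ⟨v, hv, hcv⟩ := h.exists_notMem (i := i) (Or.inl hi.ge) c
    have : v ∈ part π i := mem_part.2 hv
    rw [hp, mem_insert, mem_singleton] at this
    rcases this with rfl | rfl
    · exact hcv hu
    · exact hcv hw
  rw [hp, biUnion_insert, singleton_biUnion, card_union_of_disjoint hdisj]
  have := h.le_card u
  have := h.le_card w
  omega

theorem two_mul_le_card_pot (h : OhbaCounterexample π L) {i : Fin k} (hi : (part π i).card = 2) :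
    2 * k ≤ (pot L).card :=
  (h.two_mul_le_card_biUnion hi).trans (card_le_card (biUnion_subset_pot _))

theorem pos (h : OhbaCounterexample π L) : 0 < k := by
  by_contra hk
  obtain rfl : k = 0 := by omega
  exact h.not_colourable (fun _ => 0) (fun v => (π v).elim0) (fun v => (π v).elim0)

theorem card_eq (h : OhbaCounterexample π L) : Fintype.card V = 2 * k + 1 := by
  by_contra hne
  have hle : Fintype.card V ≤ 2 * k := by have := h.card_le; omega
  have hk := h.pos
  have hpair : ∀ i, 2 ≤ (part π i).card := by
    intro i
    by_contra hi
    obtain ⟨v, hv⟩ := card_eq_one.1 (show (part π i).card = 1 by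
      have := h.card_part_pos i; omega)
    obtain ⟨c, hc⟩ := card_pos.1 (hk.trans_le (h.le_card v))
    obtain ⟨w, hw, hcw⟩ := h.exists_notMem (i := i) (Or.inr hle) c
    have : w ∈ part π i := mem_part.2 hw
    rw [hv, mem_singleton] at this
    exact hcw (this ▸ hc)
  obtain ⟨i, hi⟩ : ∃ i, (part π i).card < 3 := by
    by_contra! hall
    have := sum_le_sum fun i (_ : i ∈ univ) => hall i
    rw [sum_card_part] at this
    simp at this
    omega
  have := h.two_mul_le_card_pot (i := i) (by have := hpair i; omega)
  have := h.card_pot_lt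
  omega

theorem card_pot_le (h : OhbaCounterexample π L) : (pot L).card ≤ 2 * k := by
  have := h.card_pot_lt
  have := h.card_eq
  omega

theorem mem_singles {v : V} : v ∈ singles π ↔ ∀ w, π w = π v → w = v := by
  have hv : v ∈ part π (π v) := mem_part.2 rfl
  simp only [singles, mem_filter, mem_univ, true_and, card_eq_one]
  constructor
  · rintro ⟨x, hx⟩ w hw
    have hw' : w ∈ part π (π v) := mem_part.2 hw
    rw [hx, mem_singleton] at hv hw'
    rw [hv, hw']
  · intro hall
    refine ⟨v, ?_⟩
    ext w
    rw [mem_part, mem_singleton]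
    exact ⟨hall w, fun hw => by rw [hw]⟩

theorem notMem_singles {v : V} : v ∉ singles π ↔ π v ∈ bigParts π := by
  have : 0 < (part π (π v)).card := card_pos.2 ⟨v, mem_part.2 rfl⟩
  rw [mem_bigParts, singles, mem_filter]
  simp only [mem_univ, true_and]
  omega

theorem card_singles_add (h : OhbaCounterexample π L) :
    (singles π).card + (bigParts π).card = k := by
  have h1 : (singles π).image π = (bigParts π)ᶜ := by
    ext i
    obtain ⟨v, rfl⟩ := h.surj i
    rw [mem_image, mem_compl, ← notMem_singles, not_not]
    constructor
    · rintro ⟨w, hw, hwv⟩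
      rwa [mem_singles.1 hw v hwv.symm]
    · exact fun hv => ⟨v, hv, rfl⟩
  have h2 : ((singles π).image π).card = (singles π).card :=
    card_image_of_injOn fun u _ w hw huw => mem_singles.1 hw u huw
  have h3 := card_compl_add_card (bigParts π)
  rw [← h1, h2, Fintype.card_fin] at h3
  exact h3

theorem sum_card_bigParts (π : V → Fin k) :
    (singles π).card + ∑ i ∈ bigParts π, (part π i).card = Fintype.card V := by
  have : ∑ i ∈ bigParts π, (part π i).card = (singles π)ᶜ.card := by
    rw [card_eq_sum_card_fiberwise (f := π) (s := (singles π)ᶜ) (t := bigParts π)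
      (fun v hv => by simpa [notMem_singles] using hv)]
    refine sum_congr rfl fun i hi => ?_
    congr 1
    ext v
    simp only [mem_part, mem_filter, mem_compl, notMem_singles]
    exact ⟨fun hv => ⟨hv ▸ hi, hv⟩, fun hv => hv.2⟩
  have h2 := card_compl_add_card (singles π)
  omega

theorem exists_three_le (h : OhbaCounterexample π L) : ∃ i, 3 ≤ (part π i).card := by
  by_contra! hall
  have := sum_le_sum fun i (_ : i ∈ univ) => Nat.le_of_lt_succ (hall i)
  rw [sum_card_part, h.card_eq] at this
  simp at this
  omega

theorem le_two_mul_card_singles (h : OhbaCounterexample π L) (hC : (pot L).card < 2 * k) :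
    k ≤ 2 * (singles π).card + 1 := by
  have h1 : ∀ i ∈ bigParts π, 3 ≤ (part π i).card := by
    intro i hi
    have := mem_bigParts.1 hi
    by_contra hlt
    have := h.two_mul_le_card_pot (i := i) (by omega)
    omega
  have h2 := sum_le_sum h1
  have h3 := sum_card_bigParts π
  have h4 := h.card_singles_add
  have h5 := h.card_eq
  rw [sum_const, smul_eq_mul] at h2
  omega

theorem card_having_add (h : OhbaCounterexample π L) (c : ℕ) :
    (having L c).card + (bigParts π).card ≤ Fintype.card V := by
  have h1 : bigParts π ⊆ (having L c)ᶜ.image π := by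
    intro i hi
    obtain ⟨v, hv, hcv⟩ := h.exists_notMem (Or.inl (mem_bigParts.1 hi)) c
    exact mem_image.2 ⟨v, by simpa [mem_having] using hcv, hv⟩
  have h2 := (card_le_card h1).trans card_image_le
  have h3 := card_compl_add_card (having L c)
  omega

theorem mul_card_le_sum (h : OhbaCounterexample π L) :
    k * (2 * k + 1) ≤ ∑ c ∈ pot L, (having L c).card := by
  have h1 : ∑ c ∈ pot L, (having L c).card = ∑ v, (L v ∩ pot L).card := sum_card_filter_mem L univ _
  have h2 : ∑ v : V, k ≤ ∑ v, (L v ∩ pot L).card := sum_le_sum fun v _ => by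
    rw [inter_eq_left.2 (subset_pot v)]
    exact h.le_card v
  rw [h1]
  simpa [h.card_eq, mul_comm] using h2

end OhbaCounterexample

/-- A colour that can be used on a vertex whose list does not contain it. -/
def Frequent {V : Type*} [Fintype V] [DecidableEq V] {k : ℕ} (π : V → Fin k)
    (L : V → Finset ℕ) (c : ℕ) : Prop :=
  Fintype.card V ≤ (having L c ∩ singles π).card + (pot L).card ∨
    ∀ T ⊆ singles π, (singles π).card + (pot L).card < T.card + Fintype.card V →
      Fintype.card V ≤ (having L c).card + max k (T.biUnion L).card

/-- A proper colouring that respects the lists except at vertices that are the only ones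
to receive a given frequent colour. -/
structure NearAcceptable {V : Type*} [Fintype V] [DecidableEq V] {k : ℕ} (π : V → Fin k)
    (L : V → Finset ℕ) (f : V → ℕ) : Prop where
  mem_pot : ∀ v, f v ∈ pot L
  proper : ∀ u w, f u = f w → π u = π w
  mem_or : ∀ v, f v ∈ L v ∨ Frequent π L (f v) ∧ ∀ w, f w = f v → w = v

namespace OhbaCounterexample

variable {V : Type*} [Fintype V] [DecidableEq V] {k : ℕ} {π : V → Fin k} {L : V → Finset ℕ}

theorem false_of_surjective_nearAcceptable (h : OhbaCounterexample π L) {f : V → ℕ}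
    (hf : NearAcceptable π L f) (hsurj : ∀ c ∈ pot L, ∃ v, f v = c) : False := by
  have hn := h.card_eq
  set t : ℕ → Finset ℕ := fun c => (pot L).filter fun d => ∀ v, f v = c → d ∈ L v with ht
  have memt : ∀ {c d}, d ∈ t c ↔ d ∈ pot L ∧ ∀ v, f v = c → d ∈ L v := by simp [ht]
  obtain ⟨S, hSs, hS, e, he, het⟩ := exists_max_deficiency (pot L) t
  set cls : ℕ → Finset V := fun c => univ.filter fun v => f v = c with hcls
  have memcls : ∀ {c v}, v ∈ cls c ↔ f v = c := by simp [hcls]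
  have hclspos : ∀ c ∈ pot L, 1 ≤ (cls c).card := fun c hc => by
    obtain ⟨v, hv⟩ := hsurj c hc
    exact card_pos.2 ⟨v, memcls.2 hv⟩
  have hsum : ∑ c ∈ pot L, (cls c).card = Fintype.card V :=
    (card_eq_sum_card_fiberwise (f := f) (s := univ) (t := pot L)
      (fun v _ => hf.mem_pot v)).symm
  set M := S.filter fun c => 2 ≤ (cls c).card with hM
  have hMS : M ⊆ S := filter_subset _ _
  set Q := univ.filter fun v => f v ∈ S ∧ f v ∉ M with hQ
  have memQ : ∀ {v}, v ∈ Q ↔ f v ∈ S ∧ f v ∉ M := by simp [hQ]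
  have hsingle : ∀ {v}, f v ∉ M → f v ∈ S → ∀ w, f w = f v → w = v := by
    intro v hvM hvS w hw
    have : (cls (f v)).card ≤ 1 := by
      by_contra hlt
      exact hvM (mem_filter.2 ⟨hvS, by omega⟩)
    exact card_le_one.1 this w (memcls.2 hw) v (memcls.2 rfl)
  have hlegit : ∀ v, f v ∈ M → f v ∈ L v := by
    intro v hv
    refine (hf.mem_or v).resolve_right fun hfr => ?_
    have h2 := (mem_filter.1 hv).2
    have : (cls (f v)).card ≤ 1 := card_le_one.2 fun a ha b hb => by
      rw [hfr.2 a (memcls.1 ha), hfr.2 b (memcls.1 hb)]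
    omega
  have htN : ∀ {c d}, c ∈ S → d ∈ t c → d ∈ S.biUnion t := fun hc hd => mem_biUnion.2 ⟨_, hc, hd⟩
  have htsingle : ∀ {v}, f v ∈ S → (∀ w, f w = f v → w = v) → L v ⊆ S.biUnion t := by
    intro v hv hw d hd
    exact htN hv (memt.2 ⟨subset_pot v hd, fun w hwv => by rwa [hw w hwv]⟩)
  have hkey : ∀ g : V → ℕ, (∀ v ∈ Q, g v ∈ L v \ M) →
      (∀ u ∈ Q, ∀ w ∈ Q, g u = g w → π u = π w) → False := by
    intro g hg hgp
    set F : V → ℕ := fun v => if f v ∈ S then (if f v ∈ M then f v else g v) else e (f v) with hF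
    have F1 : ∀ {v}, f v ∉ S → F v = e (f v) := fun hv => by simp [hF, hv]
    have F2 : ∀ {v}, f v ∈ M → F v = f v := fun hv => by simp [hF, hv, hMS hv]
    have F3 : ∀ {v}, f v ∈ S → f v ∉ M → F v = g v := fun hv hv' => by simp [hF, hv, hv']
    have FN : ∀ {v}, f v ∈ S → F v ∈ S.biUnion t := by
      intro v hv
      by_cases hvM : f v ∈ M
      · rw [F2 hvM]
        exact htN hv (memt.2 ⟨hf.mem_pot v, fun w hw => hw ▸ hlegit w (hw ▸ hvM)⟩)
      · rw [F3 hv hvM]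
        exact htsingle hv (hsingle hvM hv) (mem_sdiff.1 (hg v (memQ.2 ⟨hv, hvM⟩))).1
    have FN' : ∀ {v}, f v ∉ S → F v ∉ S.biUnion t := by
      intro v hv
      rw [F1 hv]
      exact (het _ (hf.mem_pot v) hv).2
    refine h.not_colourable F (fun v => ?_) (fun u w huw => ?_)
    · by_cases hv : f v ∈ S
      · by_cases hvM : f v ∈ M
        · rw [F2 hvM]
          exact hlegit v hvM
        · rw [F3 hv hvM]
          exact (mem_sdiff.1 (hg v (memQ.2 ⟨hv, hvM⟩))).1
      · rw [F1 hv]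
        exact (memt.1 (het _ (hf.mem_pot v) hv).1).2 v rfl
    · by_cases hu : f u ∈ S <;> by_cases hw : f w ∈ S
      · by_cases huM : f u ∈ M <;> by_cases hwM : f w ∈ M
        · rw [F2 huM, F2 hwM] at huw
          exact hf.proper u w huw
        · rw [F2 huM, F3 hw hwM] at huw
          exact absurd (huw ▸ huM) (mem_sdiff.1 (hg w (memQ.2 ⟨hw, hwM⟩))).2
        · rw [F2 hwM, F3 hu huM] at huw
          exact absurd (huw ▸ hwM) (mem_sdiff.1 (hg u (memQ.2 ⟨hu, huM⟩))).2
        · rw [F3 hu huM, F3 hw hwM] at huw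
          exact hgp u (memQ.2 ⟨hu, huM⟩) w (memQ.2 ⟨hw, hwM⟩) huw
      · exact absurd (huw ▸ FN hu) (FN' hw)
      · exact absurd (huw ▸ FN hw) (FN' hu)
      · rw [F1 hu, F1 hw] at huw
        exact hf.proper u w (he _ (hf.mem_pot u) hu _ (hf.mem_pot w) hw huw)
  have hMcard : M.card + (pot L).card ≤ Fintype.card V := by
    have h1 : ∀ c ∈ pot L, (1 + if c ∈ M then 1 else 0) ≤ (cls c).card := by
      intro c hc
      by_cases hcM : c ∈ M
      · simpa [hcM] using (mem_filter.1 hcM).2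
      · simpa [hcM] using hclspos c hc
    have h2 := sum_le_sum h1
    rw [hsum, sum_add_distrib, ← card_filter, filter_mem_eq_inter,
      inter_eq_right.2 (hMS.trans hSs)] at h2
    simp at h2
    omega
  have hQcard : Q.card + 2 * M.card ≤ Fintype.card V := by
    have h1 : ∑ c ∈ M, 2 ≤ ∑ c ∈ M, (cls c).card := sum_le_sum fun c hc => (mem_filter.1 hc).2
    have h2 : (univ.filter fun v => f v ∈ M).card = ∑ c ∈ M, (cls c).card := by
      rw [card_eq_sum_card_fiberwise (f := f) (t := M) (fun v hv => by simpa using hv)]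
      refine sum_congr rfl fun c hc => ?_
      congr 1
      ext v
      simp only [memcls, mem_filter, mem_univ, true_and]
      exact ⟨fun hv => hv.2, fun hv => ⟨hv ▸ hc, hv⟩⟩
    have h3 : Disjoint Q (univ.filter fun v => f v ∈ M) := by
      rw [Finset.disjoint_left]
      intro v hv hv'
      exact (memQ.1 hv).2 (mem_filter.1 hv').2
    have h4 := card_le_univ (Q ∪ univ.filter fun v => f v ∈ M)
    rw [card_union_of_disjoint h3] at h4
    rw [sum_const, smul_eq_mul] at h1
    omega
  set σ := (singles π).filter fun v => f v ∉ S with hσ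
  have hQuniv : Q ≠ univ := by
    intro hQu
    have hinj : Function.Injective f := by
      intro w v hwv
      obtain ⟨h1, h2⟩ := memQ.1 (hQu ▸ mem_univ v : v ∈ Q)
      exact hsingle h2 h1 w hwv
    have h1 : (univ.image f).card ≤ (pot L).card := card_le_card (by
      intro c hc
      obtain ⟨v, -, rfl⟩ := mem_image.1 hc
      exact hf.mem_pot v)
    rw [card_image_of_injective _ hinj, card_univ] at h1
    have := h.card_pot_lt
    omega
  have hσM : σ.card < M.card := by
    by_contra! hle
    have h1 : (σ.image π).card = σ.card := card_image_of_injOn fun u _ w hw huw =>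
      mem_singles.1 (mem_filter.1 hw).1 u huw
    have h2 : Q.image π ⊆ (σ.image π)ᶜ := by
      intro i hi
      obtain ⟨v, hv, rfl⟩ := mem_image.1 hi
      rw [mem_compl, mem_image]
      rintro ⟨w, hw, hwv⟩
      obtain ⟨hw1, hw2⟩ := mem_filter.1 hw
      rw [mem_singles.1 hw1 v hwv.symm] at hv
      exact hw2 (memQ.1 hv).1
    have h3 := card_le_card h2
    have h4 := card_compl_add_card (σ.image π)
    rw [Fintype.card_fin] at h4
    obtain ⟨g, hg, hgp⟩ := h.ih Q (fun v => L v \ M) (k - M.card) hQuniv (by omega) (by omega)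
      (fun v _ => by
        have := h.le_card v
        have := le_card_sdiff M (L v)
        omega)
    exact hkey g hg hgp
  have hNS : (S.biUnion t).card < S.card := by
    by_contra! hle
    obtain ⟨e', he', het'⟩ := (all_card_le_biUnion_card_iff_exists_injective
      (fun c : pot L => t c)).1 (fun X => by
        have h1 := hS (X.map (Function.Embedding.subtype _)) (by
          intro c hc
          obtain ⟨x, -, rfl⟩ := mem_map.1 hc
          exact x.2)
        rw [card_map] at h1
        have h2 : (X.map (Function.Embedding.subtype _)).biUnion t ⊆
            X.biUnion fun c : pot L => t c := by
          intro d hd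
          obtain ⟨c, hc, hcd⟩ := mem_biUnion.1 hd
          obtain ⟨x, hx, rfl⟩ := mem_map.1 hc
          exact mem_biUnion.2 ⟨x, hx, hcd⟩
        have := card_le_card h2
        omega)
    refine h.not_colourable (fun v => e' ⟨f v, hf.mem_pot v⟩) (fun v => ?_) (fun u w huw => ?_)
    · exact (memt.1 (het' ⟨f v, hf.mem_pot v⟩)).2 v rfl
    · exact hf.proper u w (congrArg Subtype.val (he' huw))
  obtain ⟨c₀, hc₀S, hc₀N⟩ := exists_mem_notMem_of_card_lt_card hNS
  obtain ⟨v₀, hv₀, hv₀L⟩ : ∃ v, f v = c₀ ∧ c₀ ∉ L v := by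
    by_contra! hall
    exact hc₀N (htN hc₀S (memt.2 ⟨hSs hc₀S, hall⟩))
  have hfreq := (hf.mem_or v₀).resolve_left (by rwa [hv₀])
  rw [hv₀] at hfreq
  have hsinglecls : ∀ v ∈ singles π, ∀ w, f w = f v → w = v := fun v hv w hw =>
    mem_singles.1 hv w (hf.proper w v hw)
  rcases hfreq with ⟨hfreq | hfreq, hcl⟩
  · have : having L c₀ ∩ singles π ⊆ σ := by
      intro v hv
      obtain ⟨hv1, hv2⟩ := mem_inter.1 hv
      refine mem_filter.2 ⟨hv2, fun hvS => ?_⟩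
      exact hc₀N (htsingle hvS (hsinglecls v hv2) (mem_having.1 hv1))
    have := card_le_card this
    omega
  · have h0 : ((singles π).filter fun v => f v ∈ S).card + σ.card = (singles π).card :=
      card_filter_add_card_filter_not _
    have h1 := hfreq ((singles π).filter fun v => f v ∈ S) (filter_subset _ _) (by
      omega)
    have h2 : k ≤ (S.biUnion t).card := (h.le_card v₀).trans (card_le_card
      (htsingle (hv₀ ▸ hc₀S) (fun w hw => hcl w (hw.trans hv₀))))
    have h3 : (((singles π).filter fun v => f v ∈ S).biUnion L).card ≤ (S.biUnion t).card := by
      refine card_le_card (biUnion_subset.2 fun v hv => ?_)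
      obtain ⟨hv1, hv2⟩ := mem_filter.1 hv
      exact htsingle hv2 (hsinglecls v hv1)
    have h4 : S ⊆ (having L c₀)ᶜ.image f := by
      intro c hc
      by_contra hcf
      refine hc₀N (htN hc (memt.2 ⟨hSs hc₀S, fun v hv => ?_⟩))
      by_contra hvL
      exact hcf (mem_image.2 ⟨v, by simpa [mem_having] using hvL, hv⟩)
    have h5 := (card_le_card h4).trans card_image_le
    have h6 := card_compl_add_card (having L c₀)
    have h7 := max_le h2 h3
    omega

theorem not_nearAcceptable (h : OhbaCounterexample π L) (f : V → ℕ) : ¬NearAcceptable π L f := by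
  intro hf
  obtain ⟨μ, hμ, hμL⟩ := h.exists_pot_matching
  obtain ⟨f, hf, hmax⟩ := exists_maximal_of_le (p := NearAcceptable π L)
    (m := fun f => ((pot L).filter fun c => f (μ c) = c).card) (pot L).card ⟨f, hf⟩
    (fun f _ => card_filter_le _ _)
  refine h.false_of_surjective_nearAcceptable hf fun c hc => ?_
  by_contra! hunused
  have hup : ∀ {v}, v ≠ μ c → Function.update f (μ c) c v = f v := fun hv =>
    Function.update_of_ne hv _ _
  have hcu : ∀ {v w}, w ≠ μ c → Function.update f (μ c) c v = f w → v ≠ μ c := by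
    rintro v w hw hvw rfl
    rw [Function.update_self] at hvw
    exact hunused w hvw.symm
  have hf' : NearAcceptable π L (Function.update f (μ c) c) := by
    refine ⟨fun v => ?_, fun u w huw => ?_, fun v => ?_⟩
    · by_cases hv : v = μ c
      · rw [hv, Function.update_self]
        exact hc
      · rw [hup hv]
        exact hf.mem_pot v
    · by_cases hw : w = μ c
      · by_cases hu : u = μ c
        · rw [hu, hw]
        · rw [hup hu] at huw
          exact absurd hw (hcu hu huw.symm)
      · rw [hup hw] at huw
        rw [hup (hcu hw huw)] at huw
        exact hf.proper u w huw
    · by_cases hv : v = μ c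
      · left
        rw [hv, Function.update_self]
        exact hμL c hc
      · rw [hup hv]
        refine (hf.mem_or v).imp_right fun hfr => ⟨hfr.1, fun w hw => ?_⟩
        rw [hup (hcu hv hw)] at hw
        exact hfr.2 w hw
  have h1 := hmax _ hf'
  refine absurd h1 (not_le.2 (card_lt_card ?_))
  rw [ssubset_iff_of_subset]
  · exact ⟨c, mem_filter.2 ⟨hc, Function.update_self _ _ _⟩,
      fun hc' => hunused _ (mem_filter.1 hc').2⟩
  · intro d hd
    obtain ⟨hd1, hd2⟩ := mem_filter.1 hd
    refine mem_filter.2 ⟨hd1, ?_⟩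
    by_cases hdc : μ d = μ c
    · rw [hμ d hd1 c hc hdc] at hd2
      exact absurd hd2 (hunused _)
    · rw [hup hdc]
      exact hd2

end OhbaCounterexample

theorem two_mul_add_one_le_of_mul_le {k x B g : ℤ} (hk : 0 ≤ k) (hB : 1 ≤ B) (hBx : B ≤ x)
    (hkB : k ≤ 2 * B - 1) (hx : x * B ≤ k * (B - 1 - g)) : 2 * g + 1 ≤ B := by
  by_contra! hlt
  have h1 : B * B ≤ x * B := mul_le_mul_of_nonneg_right hBx (by omega)
  rcases le_or_gt (B - 1 - g) 0 with hm | hm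
  · have h2 : k * (B - 1 - g) ≤ 0 := mul_nonpos_of_nonneg_of_nonpos hk hm
    nlinarith
  · have h2 : k * (B - 1 - g) ≤ (2 * B - 1) * (B - 1 - g) :=
      mul_le_mul_of_nonneg_right hkB hm.le
    have h3 : (2 * B - 1) * (2 * (B - 1 - g)) ≤ (2 * B - 1) * (B - 2) :=
      mul_le_mul_of_nonneg_left (by omega) (by omega)
    nlinarith

theorem false_of_weighted_count {k x B g : ℤ} (hg : 1 ≤ g) (hB : 2 * g + 1 ≤ B) (hBx : B ≤ x)
    (hk : 0 ≤ k) (hkB : k ≤ 2 * B - 1)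
    (h : g * (k * (2 * k + 1)) ≤
      g * ((k - x) * (k + B)) + (k - g + x) * (g * k - (B - 1 - 2 * g) * x)) : False := by
  obtain ⟨y, hy, rfl⟩ : ∃ y, 0 ≤ y ∧ B = 2 * g + 1 + y := ⟨B - 2 * g - 1, by omega, by ring⟩
  have e : g * ((2 * g + 1 + y) * x) + x * (y * (k - g + x)) ≤ g * (k * (y + g)) := by
    linarith
  have h1 : (2 * g + 1 + y) * (2 * g + 1 + y) ≤ (2 * g + 1 + y) * x :=
    mul_le_mul_of_nonneg_left hBx (by omega)
  have h2 : g * ((2 * g + 1 + y) * (2 * g + 1 + y)) ≤ g * ((2 * g + 1 + y) * x) :=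
    mul_le_mul_of_nonneg_left h1 (by omega)
  have h3 : g * (y * k) ≤ x * (y * (k - g + x)) :=
    mul_le_mul (by omega) (mul_le_mul_of_nonneg_left (by omega) hy) (by positivity) (by omega)
  have h4 : g * (g * k) ≤ g * (g * (2 * (2 * g + 1 + y) - 1)) :=
    mul_le_mul_of_nonneg_left (mul_le_mul_of_nonneg_left hkB (by omega)) (by omega)
  have h5 : g * (g * (2 * (2 * g + 1 + y) - 1)) < g * ((2 * g + 1 + y) * (2 * g + 1 + y)) := by
    refine mul_lt_mul_of_pos_left ?_ (by omega)
    nlinarith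
  linarith

namespace OhbaCounterexample

variable {V : Type*} [Fintype V] [DecidableEq V] {k : ℕ} {π : V → Fin k} {L : V → Finset ℕ}

open Classical in
theorem card_bigParts_le_card_frequent (h : OhbaCounterexample π L) :
    (bigParts π).card ≤ ((pot L).filter (Frequent π L)).card := by
  by_contra! hlt
  set F := (pot L).filter (Frequent π L) with hF
  have hFs : F ⊆ pot L := filter_subset _ _
  have hn := h.card_eq
  have hb := h.card_singles_add
  have hpot := h.card_pot_le
  have hkpos := h.pos
  have hsum := h.mul_card_le_sum
  rw [← sum_sdiff hFs] at hsum
  have hRcard : (pot L \ F).card + F.card = (pot L).card := card_sdiff_add_card_eq_card hFs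
  have hnot : ∀ c ∈ pot L \ F, (having L c ∩ singles π).card + (pot L).card ≤ 2 * k ∧
      ∃ T ⊆ singles π, (singles π).card + (pot L).card < T.card + (2 * k + 1) ∧
        (having L c).card ≤ k ∧ (having L c).card + (T.biUnion L).card ≤ 2 * k := by
    intro c hc
    obtain ⟨hc1, hc2⟩ := mem_sdiff.1 hc
    have hc3 : ¬Frequent π L c := fun hfr => hc2 (mem_filter.2 ⟨hc1, hfr⟩)
    simp only [Frequent, not_or, not_forall, not_le, hn] at hc3
    obtain ⟨h1, T, hT, h2, h3⟩ := hc3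
    have := le_max_left k (T.biUnion L).card
    have := le_max_right k (T.biUnion L).card
    exact ⟨by omega, T, hT, h2, by omega, by omega⟩
  have hFsum : ∑ c ∈ F, (having L c).card ≤ F.card * (k + 1 + (singles π).card) := by
    rw [← smul_eq_mul, ← sum_const]
    refine sum_le_sum fun c _ => ?_
    have := h.card_having_add c
    omega
  have hRsum : ∑ c ∈ pot L \ F, (having L c).card ≤ (pot L \ F).card * k := by
    rw [← smul_eq_mul, ← sum_const]
    exact sum_le_sum fun c hc => (hnot c hc).2.choose_spec.2.2.1
  rcases hpot.eq_or_lt with hp | hp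
  · rcases (singles π).eq_empty_or_nonempty with he | ⟨v, hv⟩
    · rw [he, card_empty] at hb hFsum
      nlinarith
    · have : L v ⊆ F := by
        intro c hc
        by_contra hcF
        have h1 := (hnot c (mem_sdiff.2 ⟨subset_pot v hc, hcF⟩)).1
        have : 0 < (having L c ∩ singles π).card :=
          card_pos.2 ⟨v, mem_inter.2 ⟨mem_having.2 hc, hv⟩⟩
        omega
      have := card_le_card this
      have := h.le_card v
      omega
  · have hkb := h.le_two_mul_card_singles hp
    obtain ⟨g, hg⟩ : ∃ g, (pot L).card + g = 2 * k := ⟨2 * k - (pot L).card, by omega⟩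
    obtain ⟨x, hx⟩ : ∃ x, F.card + x = k := ⟨k - F.card, by omega⟩
    have hfZ : (F.card : ℤ) = k - x := by omega
    have hRZ : ((pot L \ F).card : ℤ) = k - g + x := by omega
    have hB : (2 * g + 1 : ℤ) ≤ (singles π).card + 1 := by
      refine two_mul_add_one_le_of_mul_le (k := k) (x := x) (by omega) (by omega) (by omega)
        (by omega) ?_
      have h1 : (k * (2 * k + 1) : ℤ) ≤ (pot L \ F).card * k + F.card *
          (k + 1 + (singles π).card) := by exact_mod_cast hsum.trans (add_le_add hRsum hFsum)
      rw [hfZ, hRZ] at h1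
      linarith
    refine false_of_weighted_count (k := k) (x := x) (B := (singles π).card + 1) (g := g) (by omega)
      hB (by omega) (by omega) (by omega) ?_
    have hd : ∀ c ∈ pot L \ F, (g * (having L c).card : ℤ) ≤
        g * k - ((singles π).card - 2 * g) * x := by
      intro c hc
      obtain ⟨-, T, hT, hTc, -, hdT⟩ := hnot c hc
      have h1 : ∑ d ∈ T.biUnion L \ F, (T.filter fun v => d ∈ L v).card ≤
          (T.biUnion L \ F).card * g := by
        rw [← smul_eq_mul, ← sum_const]
        refine sum_le_sum fun d hd => ?_
        have h2 := (hnot d (sdiff_subset_sdiff (biUnion_subset_pot T) subset_rfl hd)).1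
        have h3 : T.filter (fun v => d ∈ L v) ⊆ having L d ∩ singles π := by
          intro v hv
          obtain ⟨hv1, hv2⟩ := mem_filter.1 hv
          exact mem_inter.2 ⟨mem_having.2 hv2, hT hv1⟩
        have := card_le_card h3
        omega
      rw [sum_card_filter_mem] at h1
      have h2 : (T.biUnion L \ F).card + (F ∩ T.biUnion L).card = (T.biUnion L).card := by
        rw [inter_comm, card_sdiff_add_card_inter]
      have h3 : T.card * (k - (F ∩ T.biUnion L).card) ≤
          ∑ v ∈ T, (L v ∩ (T.biUnion L \ F)).card := by
        rw [← smul_eq_mul, ← sum_const]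
        refine sum_le_sum fun v hv => ?_
        have h4 : L v ⊆ (L v ∩ (T.biUnion L \ F)) ∪ (F ∩ T.biUnion L) := by
          intro d hd
          have : d ∈ T.biUnion L := mem_biUnion.2 ⟨v, hv, hd⟩
          by_cases hdF : d ∈ F <;> simp_all
        have := (card_le_card h4).trans (card_union_le _ _)
        have := h.le_card v
        omega
      have h4 : (F ∩ T.biUnion L).card ≤ F.card := card_le_card inter_subset_left
      have h5 := h3.trans h1
      obtain ⟨y, hy⟩ : ∃ y, (F ∩ T.biUnion L).card + y = k :=
        ⟨k - (F ∩ T.biUnion L).card, by omega⟩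
      rw [show k - (F ∩ T.biUnion L).card = y by omega] at h5
      have h6 : ((singles π).card - g : ℤ) * y ≤ (T.biUnion L \ F).card * g := by
        have h7 : (T.card * y : ℤ) ≤ (T.biUnion L \ F).card * g := by exact_mod_cast h5
        exact (mul_le_mul_of_nonneg_right (by omega) (by omega)).trans h7
      have h7 : ((T.biUnion L \ F).card : ℤ) = (T.biUnion L).card - (k - y) := by omega
      rw [h7] at h6
      have h8 : (0 : ℤ) ≤ ((singles π).card - 2 * g) * (y - x) :=
        mul_nonneg (by omega) (by omega)
      have h9 : (g * (having L c).card : ℤ) ≤ g * (2 * k - (T.biUnion L).card) :=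
        mul_le_mul_of_nonneg_left (by omega) (by omega)
      linarith
    have hRd := sum_le_sum hd
    rw [sum_const, ← mul_sum, nsmul_eq_mul, hRZ] at hRd
    have h1 : (g * (k * (2 * k + 1)) : ℤ) ≤ g * (∑ c ∈ pot L \ F, ((having L c).card : ℤ)) +
        g * (F.card * (k + 1 + (singles π).card)) := by
      rw [← mul_add]
      refine mul_le_mul_of_nonneg_left ?_ (by omega)
      exact_mod_cast hsum.trans (add_le_add le_rfl hFsum)
    rw [hfZ] at h1
    linarith

end OhbaCounterexample

/-- A set `F` of frequent colours, one for each part with several vertices, and distinct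
colours `d v` outside `F` for the vertices `v` forming parts on their own. -/
structure Palette {V : Type*} [Fintype V] [DecidableEq V] {k : ℕ} (π : V → Fin k)
    (L : V → Finset ℕ) (F : Finset ℕ) (d : V → ℕ) : Prop where
  subset : F ⊆ pot L
  card : F.card = (bigParts π).card
  frequent : ∀ c ∈ F, Frequent π L c
  injOn : ∀ u ∈ singles π, ∀ w ∈ singles π, d u = d w → u = w
  mem : ∀ v ∈ singles π, d v ∈ L v
  notMem : ∀ v ∈ singles π, d v ∉ F

/-- The colours of a palette. -/
def Palette.colours {V : Type*} [Fintype V] [DecidableEq V] {k : ℕ} (π : V → Fin k)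
    (F : Finset ℕ) (d : V → ℕ) : Finset ℕ := F ∪ (singles π).image d

/-- A partial proper colouring of the vertices in the parts with several vertices by colours
outside of `A`. -/
structure PartialColouring {V : Type*} [Fintype V] [DecidableEq V] {k : ℕ} (π : V → Fin k)
    (L : V → Finset ℕ) (A : Finset ℕ) (W : Finset V) (ψ : V → ℕ) : Prop where
  notMem_singles : ∀ v ∈ W, v ∉ singles π
  mem : ∀ v ∈ W, ψ v ∈ L v
  notMem : ∀ v ∈ W, ψ v ∉ A
  proper : ∀ u ∈ W, ∀ w ∈ W, ψ u = ψ w → π u = π w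

namespace OhbaCounterexample

variable {V : Type*} [Fintype V] [DecidableEq V] {k : ℕ} {π : V → Fin k} {L : V → Finset ℕ}

theorem exists_palette (h : OhbaCounterexample π L) : ∃ F d, Palette π L F d := by
  classical
  obtain ⟨F, hF, hFb⟩ := exists_subset_card_eq h.card_bigParts_le_card_frequent
  have hb := h.card_singles_add
  obtain ⟨d, hd, hdL⟩ := exists_injOn_of_card_le (singles π) (fun v => L v \ F) fun v _ => by
    have := h.le_card v
    have := le_card_sdiff F (L v)
    omega
  exact ⟨F, d, hF.trans (filter_subset _ _), hFb, fun c hc => (mem_filter.1 (hF hc)).2,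
    fun u hu w hw huw => hd hu hw huw, fun v hv => (mem_sdiff.1 (hdL v hv)).1,
    fun v hv => (mem_sdiff.1 (hdL v hv)).2⟩

section

variable {F : Finset ℕ} {d : V → ℕ} {W : Finset V} {ψ : V → ℕ}

theorem card_colours (h : OhbaCounterexample π L) (hp : Palette π L F d) :
    (Palette.colours π F d).card = k := by
  rw [Palette.colours, card_union_of_disjoint, card_image_of_injOn, hp.card, add_comm,
    h.card_singles_add]
  · exact fun u hu w hw huw => hp.injOn u hu w hw huw
  · rw [Finset.disjoint_left]
    intro c hc hc'
    obtain ⟨v, hv, rfl⟩ := mem_image.1 hc'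
    exact hp.notMem v hv hc

theorem colours_subset (hp : Palette π L F d) : Palette.colours π F d ⊆ pot L := by
  refine union_subset hp.subset fun c hc => ?_
  obtain ⟨v, hv, rfl⟩ := mem_image.1 hc
  exact subset_pot v (hp.mem v hv)

theorem false_of_merge (h : OhbaCounterexample π L) (hp : Palette π L F d)
    (hW : PartialColouring π L (Palette.colours π F d) W ψ) {J : Finset (Fin k)} {a : Fin k → ℕ}
    (ha : Set.InjOn a J) (haA : ∀ i ∈ J, a i ∈ Palette.colours π F d) {Y : Finset V}
    (hY : ∀ v ∈ Y, v ∉ singles π ∧ v ∉ W ∧ π v ∈ J ∧ a (π v) ∈ L v)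
    (hcard : k + 1 + J.card ≤ W.card + Y.card) : False := by
  set A := Palette.colours π F d with hA
  have hn := h.card_eq
  have hFA : F ⊆ A := subset_union_left
  have hdA : ∀ v ∈ singles π, d v ∈ A := fun v hv =>
    mem_union_right _ (mem_image_of_mem d hv)
  set S := (singles π).filter fun v => d v ∉ J.image a with hS
  have hWY : Disjoint W Y := Finset.disjoint_right.2 fun v hv => (hY v hv).2.1
  have hWYS : Disjoint (W ∪ Y) S := by
    rw [Finset.disjoint_left]
    intro v hv hvS
    have hvs := (mem_filter.1 hvS).1
    rcases mem_union.1 hv with hv | hv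
    · exact hW.notMem_singles v hv hvs
    · exact (hY v hv).1 hvs
  have hJ : (J.image a).card = J.card := card_image_of_injOn ha
  have hFcard : A.card ≤ J.card + (F \ J.image a).card + S.card := by
    have h1 : A ⊆ J.image a ∪ F \ J.image a ∪ S.image d := by
      intro c hc
      by_cases hcJ : c ∈ J.image a
      · exact mem_union_left _ (mem_union_left _ hcJ)
      · rcases mem_union.1 hc with hc | hc
        · exact mem_union_left _ (mem_union_right _ (mem_sdiff.2 ⟨hc, hcJ⟩))
        · obtain ⟨v, hv, rfl⟩ := mem_image.1 hc
          exact mem_union_right _ (mem_image_of_mem d (mem_filter.2 ⟨hv, hcJ⟩))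
    have h2 := card_le_card h1
    have h3 := card_union_le (J.image a ∪ F \ J.image a) (S.image d)
    have h4 := card_union_le (J.image a) (F \ J.image a)
    have h5 : (S.image d).card ≤ S.card := card_image_le
    omega
  rw [hA, h.card_colours hp] at hFcard
  have hZcard := card_compl_add_card (W ∪ Y ∪ S)
  rw [card_union_of_disjoint hWYS, card_union_of_disjoint hWY] at hZcard
  obtain ⟨ζ, hζ, hζF⟩ := exists_injOn_of_card_le (W ∪ Y ∪ S)ᶜ (fun _ => F \ J.image a)
    (fun v _ => by omega)
  have hζF' : ∀ v, v ∉ W ∪ Y ∪ S → ζ v ∈ F ∧ ζ v ∉ J.image a := fun v hv =>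
    mem_sdiff.1 (hζF v (mem_compl.2 hv))
  set f : V → ℕ := fun v => if v ∈ W then ψ v else if v ∈ Y then a (π v) else
    if v ∈ S then d v else ζ v with hf
  have hcase : ∀ v, (v ∈ W ∧ f v = ψ v ∧ f v ∉ A) ∨
      (v ∈ Y ∧ f v = a (π v) ∧ f v ∈ A ∧ f v ∈ J.image a) ∨
      (v ∈ S ∧ f v = d v ∧ f v ∈ A ∧ f v ∉ J.image a ∧ f v ∉ F) ∨
      (v ∉ W ∪ Y ∪ S ∧ f v = ζ v ∧ f v ∈ A ∧ f v ∉ J.image a ∧ f v ∈ F) := by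
    intro v
    by_cases hvW : v ∈ W
    · have hfv : f v = ψ v := by simp [hf, hvW]
      exact Or.inl ⟨hvW, hfv, hfv ▸ hW.notMem v hvW⟩
    by_cases hvY : v ∈ Y
    · have hfv : f v = a (π v) := by simp [hf, hvW, hvY]
      have hvJ := (hY v hvY).2.2.1
      exact Or.inr (Or.inl ⟨hvY, hfv, hfv ▸ haA _ hvJ, hfv ▸ mem_image_of_mem a hvJ⟩)
    by_cases hvS : v ∈ S
    · have hfv : f v = d v := by simp [hf, hvW, hvY, hvS]
      obtain ⟨h1, h2⟩ := mem_filter.1 hvS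
      exact Or.inr (Or.inr (Or.inl
        ⟨hvS, hfv, hfv ▸ hdA v h1, hfv ▸ h2, hfv ▸ hp.notMem v h1⟩))
    · have hfv : f v = ζ v := by simp [hf, hvW, hvY, hvS]
      have hv : v ∉ W ∪ Y ∪ S := by simp [hvW, hvY, hvS]
      obtain ⟨h1, h2⟩ := hζF' v hv
      exact Or.inr (Or.inr (Or.inr ⟨hv, hfv, hfv ▸ hFA h1, hfv ▸ h2, hfv ▸ h1⟩))
  have hζinj : ∀ u w, u ∉ W ∪ Y ∪ S → w ∉ W ∪ Y ∪ S → ζ u = ζ w → u = w := fun u w hu hw huw =>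
    hζ (mem_coe.2 (mem_compl.2 hu)) (mem_coe.2 (mem_compl.2 hw)) huw
  refine h.not_nearAcceptable f ⟨fun v => ?_, fun u w huw => ?_, fun v => ?_⟩
  · rcases hcase v with ⟨hv, hfv, -⟩ | ⟨-, -, hv, -⟩ | ⟨-, -, hv, -⟩ | ⟨-, -, hv, -⟩
    · exact hfv ▸ subset_pot v (hW.mem v hv)
    all_goals exact colours_subset hp hv
  · rcases hcase u with ⟨hu, hfu, hu1⟩ | ⟨hu, hfu, hu1, hu2⟩ | ⟨hu, hfu, hu1, hu2, hu3⟩ |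
        ⟨hu, hfu, hu1, hu2, hu3⟩ <;>
      rcases hcase w with ⟨hw, hfw, hw1⟩ | ⟨hw, hfw, hw1, hw2⟩ | ⟨hw, hfw, hw1, hw2, hw3⟩ |
        ⟨hw, hfw, hw1, hw2, hw3⟩ <;>
      first
      | (rw [huw] at hu1; contradiction)
      | (rw [huw] at hu2; contradiction)
      | (rw [huw] at hu3; contradiction)
      | skip
    · exact hW.proper u hu w hw (hfu ▸ hfw ▸ huw)
    · exact ha (hY u hu).2.2.1 (hY w hw).2.2.1 (hfu ▸ hfw ▸ huw)
    · rw [hp.injOn u (mem_filter.1 hu).1 w (mem_filter.1 hw).1 (hfu ▸ hfw ▸ huw)]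
    · rw [hζinj u w hu hw (hfu ▸ hfw ▸ huw)]
  · rcases hcase v with ⟨hv, hfv, -⟩ | ⟨hv, hfv, -⟩ | ⟨hv, hfv, -⟩ | ⟨hv, hfv, hv1, hv2, hv3⟩
    · exact Or.inl (hfv ▸ hW.mem v hv)
    · exact Or.inl (hfv ▸ (hY v hv).2.2.2)
    · exact Or.inl (hfv ▸ hp.mem v (mem_filter.1 hv).1)
    · refine Or.inr ⟨hp.frequent _ hv3, fun w hwv => ?_⟩
      rcases hcase w with ⟨-, -, hw⟩ | ⟨-, -, -, hw⟩ | ⟨-, -, -, -, hw⟩ | ⟨hw, hfw, -⟩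
      · exact absurd (hwv ▸ hv1) hw
      · exact absurd (hwv ▸ hw) hv2
      · exact absurd (hwv ▸ hv3) hw
      · exact hζinj w v hw hv (hfw ▸ hfv ▸ hwv)

theorem exchange {A : Finset ℕ} (hW : PartialColouring π L A W ψ) {i : Fin k}
    (hi : i ∈ bigParts π) {c : ℕ} (hc : c ∉ A) :
    PartialColouring π L A
      ((W.filter fun v => ¬(ψ v = c ∧ π v ≠ i)) ∪ (part π i \ W).filter fun v => c ∈ L v)
      (fun v => if v ∈ W then ψ v else c) := by
  have hcase : ∀ v ∈ (W.filter fun v => ¬(ψ v = c ∧ π v ≠ i)) ∪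
      (part π i \ W).filter fun v => c ∈ L v,
      (v ∈ W ∧ (ψ v = c → π v = i)) ∨ (v ∉ W ∧ π v = i ∧ c ∈ L v) := by
    intro v hv
    simp only [mem_union, mem_filter, mem_sdiff, mem_part] at hv
    tauto
  refine ⟨fun v hv => ?_, fun v hv => ?_, fun v hv => ?_, fun u hu w hw huw => ?_⟩
  · rcases hcase v hv with ⟨hv, -⟩ | ⟨-, hv, -⟩
    · exact hW.notMem_singles v hv
    · exact notMem_singles.2 (hv ▸ hi)
  · rcases hcase v hv with ⟨hv, -⟩ | ⟨hv, -, hvc⟩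
    · simpa [hv] using hW.mem v hv
    · simpa [hv] using hvc
  · rcases hcase v hv with ⟨hv, -⟩ | ⟨hv, -, hvc⟩
    · simpa [hv] using hW.notMem v hv
    · simpa [hv] using hc
  · rcases hcase u hu with ⟨hu, hu'⟩ | ⟨hu, hu', -⟩ <;>
      rcases hcase w hw with ⟨hw, hw'⟩ | ⟨hw, hw', -⟩ <;>
      simp only [hu, hw, if_true, if_false] at huw
    · exact hW.proper u hu w hw huw
    · rw [hu' huw, hw']
    · rw [hu', hw' huw.symm]
    · rw [hu', hw']

end

end OhbaCounterexample

/-- A partial colouring with the maximal number of coloured vertices which, subject to this,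
leaves as many vertices as possible of the part `i₀` uncoloured. -/
structure MaxColouring {V : Type*} [Fintype V] [DecidableEq V] {k : ℕ} (π : V → Fin k)
    (L : V → Finset ℕ) (A : Finset ℕ) (i₀ : Fin k) (W : Finset V) (ψ : V → ℕ) : Prop where
  isPartial : PartialColouring π L A W ψ
  max : ∀ W' ψ', PartialColouring π L A W' ψ' →
    (Fintype.card V + 1) * W'.card + (part π i₀ \ W').card ≤
      (Fintype.card V + 1) * W.card + (part π i₀ \ W).card

namespace OhbaCounterexample

variable {V : Type*} [Fintype V] [DecidableEq V] {k : ℕ} {π : V → Fin k} {L : V → Finset ℕ}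
  {A : Finset ℕ} {i₀ i : Fin k} {W : Finset V} {ψ : V → ℕ}

theorem exists_maxColouring (π : V → Fin k) (L : V → Finset ℕ) (A : Finset ℕ) (i₀ : Fin k) :
    ∃ W ψ, MaxColouring π L A i₀ W ψ := by
  obtain ⟨⟨W, ψ⟩, hW, hmax⟩ := exists_maximal_of_le
    (p := fun x : Finset V × (V → ℕ) => PartialColouring π L A x.1 x.2)
    (m := fun x => (Fintype.card V + 1) * x.1.card + (part π i₀ \ x.1).card)
    ((Fintype.card V + 1) * Fintype.card V + Fintype.card V)
    ⟨(∅, fun _ => 0), by simp, by simp, by simp, by simp⟩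
    (fun x _ => add_le_add (Nat.mul_le_mul_left _ (card_le_univ _)) (card_le_univ _))
  exact ⟨W, ψ, hW, fun W' ψ' hW' => hmax (W', ψ') hW'⟩

theorem card_exchange (W : Finset V) (ψ : V → ℕ) (i : Fin k) (c : ℕ) :
    ((W.filter fun v => ¬(ψ v = c ∧ π v ≠ i)) ∪
        (part π i \ W).filter fun v => c ∈ L v).card +
      (W.filter fun v => ψ v = c ∧ π v ≠ i).card =
    W.card + ((part π i \ W).filter fun v => c ∈ L v).card := by
  rw [card_union_of_disjoint]
  · have := card_filter_add_card_filter_not (s := W) (fun v => ψ v = c ∧ π v ≠ i)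
    omega
  · rw [Finset.disjoint_left]
    intro v hv hv'
    exact (mem_sdiff.1 (mem_filter.1 hv').1).2 (mem_filter.1 hv).1

theorem card_filter_le_of_max (hW : MaxColouring π L A i₀ W ψ) (hi : i ∈ bigParts π) {c : ℕ}
    (hc : c ∉ A) : ((part π i \ W).filter fun v => c ∈ L v).card ≤
      (W.filter fun v => ψ v = c ∧ π v ≠ i).card := by
  have h1 := hW.max _ _ (exchange hW.isPartial hi hc)
  have h2 := card_exchange (π := π) (L := L) W ψ i c
  have h3 := card_le_univ (part π i₀ \ W)
  by_contra! hlt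
  set W' := (W.filter fun v => ¬(ψ v = c ∧ π v ≠ i)) ∪ (part π i \ W).filter fun v => c ∈ L v
  have h4 : (Fintype.card V + 1) * (W.card + 1) ≤ (Fintype.card V + 1) * W'.card :=
    Nat.mul_le_mul_left _ (by omega)
  rw [mul_add] at h4
  omega

theorem sum_card_filter_eq (hp : PartialColouring π L A W ψ) (i : Fin k) :
    ∑ c ∈ pot L \ A, (W.filter fun v => ψ v = c ∧ π v ≠ i).card =
      (W.filter fun v => π v ≠ i).card := by
  rw [card_eq_sum_card_fiberwise (f := ψ) (t := pot L \ A)]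
  · refine sum_congr rfl fun c _ => ?_
    rw [filter_filter]
    simp only [and_comm]
  · intro v hv
    have hv : v ∈ W := (mem_filter.1 (mem_coe.1 hv)).1
    exact mem_coe.2 (mem_sdiff.2 ⟨subset_pot v (hp.mem v hv), hp.notMem v hv⟩)

theorem sum_card_missing_le (h : OhbaCounterexample π L) (hA : A.card = k)
    (hW : MaxColouring π L A i₀ W ψ) (hi : i ∈ bigParts π) :
    ∑ a ∈ A, ((part π i \ W).filter fun v => a ∉ L v).card ≤
      (W.filter fun v => π v ≠ i).card := by
  rw [← sum_card_filter_eq hW.isPartial i]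
  refine le_trans ?_ (sum_le_sum fun c hc =>
    card_filter_le_of_max hW hi (mem_sdiff.1 hc).2)
  rw [sum_card_filter_mem]
  have h1 : ∑ a ∈ A, ((part π i \ W).filter fun v => a ∉ L v).card =
      ∑ v ∈ part π i \ W, (A \ L v).card := by
    simp only [card_filter]
    rw [sum_comm]
    refine sum_congr rfl fun v _ => ?_
    rw [← card_filter, filter_notMem_eq_sdiff]
  rw [h1]
  refine sum_le_sum fun v _ => ?_
  have h2 := h.le_card v
  have h3 : L v ∩ (pot L \ A) = L v \ A := by
    ext c
    simp only [mem_inter, mem_sdiff]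
    exact ⟨fun hc => ⟨hc.1, hc.2.2⟩, fun hc => ⟨hc.1, subset_pot v hc.1, hc.2⟩⟩
  have h4 := card_sdiff_add_card_inter (L v) A
  have h5 := card_sdiff_add_card_inter A (L v)
  rw [inter_comm] at h5
  rw [h3]
  omega

theorem le_card_common_add (h : OhbaCounterexample π L) (hA : A.card = k)
    (hW : MaxColouring π L A i₀ W ψ) (hi : i ∈ bigParts π) :
    k ≤ (A.filter fun a => ∀ v ∈ part π i \ W, a ∈ L v).card +
      (W.filter fun v => π v ≠ i).card := by
  have h1 := h.sum_card_missing_le hA hW hi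
  have h2 := card_filter_add_card_filter_not (s := A) (fun a => ∀ v ∈ part π i \ W, a ∈ L v)
  have h3 : (A.filter fun a => ¬∀ v ∈ part π i \ W, a ∈ L v).card ≤
      ∑ a ∈ A, ((part π i \ W).filter fun v => a ∉ L v).card := by
    rw [card_filter]
    refine sum_le_sum fun a _ => ?_
    by_cases ha : ∀ v ∈ part π i \ W, a ∈ L v
    · rw [if_neg (not_not.2 ha)]
      exact Nat.zero_le _
    · rw [if_pos ha]
      push Not at ha
      obtain ⟨v, hv, hav⟩ := ha
      exact card_pos.2 ⟨v, mem_filter.2 ⟨hv, hav⟩⟩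
  omega

theorem sum_card_uncoloured (hW : PartialColouring π L A W ψ) :
    (singles π).card + W.card + ∑ i ∈ bigParts π, (part π i \ W).card = Fintype.card V := by
  have h1 : W.card = ∑ i ∈ bigParts π, (part π i ∩ W).card := by
    rw [card_eq_sum_card_fiberwise (f := π) (t := bigParts π)
      (fun v hv => notMem_singles.1 (hW.notMem_singles v hv))]
    refine sum_congr rfl fun i _ => ?_
    congr 1
    ext v
    simp only [mem_filter, mem_inter, mem_part, and_comm]
  have h2 : ∑ i ∈ bigParts π, (part π i).card =
      ∑ i ∈ bigParts π, (part π i \ W).card + ∑ i ∈ bigParts π, (part π i ∩ W).card := by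
    rw [← sum_add_distrib]
    exact sum_congr rfl fun i _ => (card_sdiff_add_card_inter _ _).symm
  have h3 := sum_card_bigParts π
  omega

theorem card_filter_ne_add (W : Finset V) (i : Fin k) :
    (W.filter fun v => π v ≠ i).card + (part π i ∩ W).card = W.card := by
  have h1 : part π i ∩ W = W.filter fun v => π v = i := by
    ext v
    simp only [mem_inter, mem_part, mem_filter, and_comm]
  rw [h1, add_comm]
  exact card_filter_add_card_filter_not _

section

variable {F : Finset ℕ} {d : V → ℕ}

/-- If every part with two uncoloured vertices also has a coloured vertex, the uncoloured
vertices of several parts can be merged. -/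
theorem exists_inter_eq_empty (h : OhbaCounterexample π L) (hp : Palette π L F d)
    (hW : MaxColouring π L (Palette.colours π F d) i₀ W ψ) :
    ∃ i ∈ bigParts π, 2 ≤ (part π i \ W).card ∧ part π i ∩ W = ∅ := by
  by_contra! hall
  set A := Palette.colours π F d
  have hA : A.card = k := h.card_colours hp
  have hn := h.card_eq
  have hb := h.card_singles_add
  have hsum := sum_card_uncoloured hW.isPartial
  set J₀ := (bigParts π).filter fun i => 2 ≤ (part π i \ W).card with hJ₀
  obtain ⟨J, hJJ₀, hJ⟩ := exists_subset_card_eq (Nat.min_le_right (k + 1 - W.card) J₀.card)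
  have hJbig : ∀ i ∈ J, i ∈ bigParts π ∧ 2 ≤ (part π i \ W).card := fun i hi =>
    mem_filter.1 (hJJ₀ hi)
  have hJle : J.card ≤ k + 1 - W.card := hJ ▸ Nat.min_le_left _ _
  obtain ⟨a, ha, haN⟩ := exists_injOn_of_card_le J
    (fun i => A.filter fun a => ∀ v ∈ part π i \ W, a ∈ L v) (fun i hi => by
      have h1 := h.le_card_common_add hA hW (hJbig i hi).1
      have h2 := card_filter_ne_add (π := π) W i
      have h3 := card_pos.2 (hall i (hJbig i hi).1 (hJbig i hi).2)
      omega)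
  have hYcard : (J.biUnion fun i => part π i \ W).card = ∑ i ∈ J, (part π i \ W).card := by
    refine card_biUnion fun i _ j _ hij => ?_
    rw [Function.onFun, Finset.disjoint_left]
    intro v hv hv'
    exact hij ((mem_part.1 (mem_sdiff.1 hv).1).symm.trans (mem_part.1 (mem_sdiff.1 hv').1))
  refine h.false_of_merge hp hW.isPartial ha (fun i hi => (mem_filter.1 (haN i hi)).1)
    (Y := J.biUnion fun i => part π i \ W) (fun v hv => ?_) ?_
  · obtain ⟨i, hi, hv⟩ := mem_biUnion.1 hv
    obtain ⟨hv1, hv2⟩ := mem_sdiff.1 hv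
    have hvi := mem_part.1 hv1
    refine ⟨notMem_singles.2 (hvi ▸ (hJbig i hi).1), hv2, hvi ▸ hi, ?_⟩
    rw [hvi]
    exact (mem_filter.1 (haN i hi)).2 v hv
  · rw [hYcard]
    rcases le_total (k + 1 - W.card) J₀.card with hle | hle
    · have h1 : ∑ i ∈ J, 2 ≤ ∑ i ∈ J, (part π i \ W).card :=
        sum_le_sum fun i hi => (hJbig i hi).2
      rw [min_eq_left hle] at hJ
      rw [sum_const, smul_eq_mul] at h1
      omega
    · rw [min_eq_right hle] at hJ
      have hJeq : J = J₀ := eq_of_subset_of_card_le hJJ₀ hJ.ge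
      have h1 : ∑ i ∈ bigParts π \ J, (part π i \ W).card ≤ ∑ i ∈ bigParts π \ J, 1 := by
        refine sum_le_sum fun i hi => ?_
        obtain ⟨hi1, hi2⟩ := mem_sdiff.1 hi
        by_contra hlt
        exact hi2 (hJeq ▸ mem_filter.2 ⟨hi1, by omega⟩)
      have hsub : J ⊆ bigParts π := fun i hi => (hJbig i hi).1
      have h2 := sum_sdiff (f := fun i => (part π i \ W).card) hsub
      have h3 := card_sdiff_add_card_eq_card hsub
      rw [sum_const, smul_eq_mul, mul_one] at h1
      omega

theorem card_eq_of_inter_eq_empty (h : OhbaCounterexample π L) (hp : Palette π L F d)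
    (hW : MaxColouring π L (Palette.colours π F d) i₀ W ψ) (hi : i ∈ bigParts π)
    (hiW : part π i ∩ W = ∅) : W.card = k := by
  have h1 := h.le_card_common_add (h.card_colours hp) hW hi
  have h2 : (Palette.colours π F d).filter (fun a => ∀ v ∈ part π i \ W, a ∈ L v) = ∅ := by
    rw [filter_eq_empty_iff]
    intro a _ hall
    obtain ⟨v, hv, hav⟩ := h.exists_notMem (Or.inl (mem_bigParts.1 hi)) a
    refine hav (hall v (mem_sdiff.2 ⟨mem_part.2 hv, fun hvW => ?_⟩))
    exact notMem_empty v (hiW ▸ mem_inter.2 ⟨mem_part.2 hv, hvW⟩)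
  rw [h2, card_empty] at h1
  have h3 := card_filter_ne_add (π := π) W i
  rw [hiW, card_empty] at h3
  by_contra hne
  exact h.false_of_merge hp hW.isPartial (J := ∅) (a := fun _ => 0) (by simp) (by simp)
    (Y := ∅) (by simp) (by simp; omega)

/-- When exactly `k` vertices are coloured, no two uncoloured vertices in a large or
partially coloured part can be merged. -/
theorem card_part_of_card_eq (h : OhbaCounterexample π L) (hp : Palette π L F d)
    (hW : MaxColouring π L (Palette.colours π F d) i₀ W ψ) (hWk : W.card = k)
    (hi : i ∈ bigParts π) (hi2 : 2 ≤ (part π i \ W).card) :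
    part π i ∩ W = ∅ ∧ (part π i).card = 2 := by
  have hsum := h.sum_card_missing_le (h.card_colours hp) hW hi
  have h1 : ∀ a ∈ Palette.colours π F d, (part π i \ W).card - 1 ≤
      ((part π i \ W).filter fun v => a ∉ L v).card := by
    intro a ha
    by_contra! hlt
    have h2 := card_filter_add_card_filter_not (s := part π i \ W) (fun v => a ∈ L v)
    refine h.false_of_merge hp hW.isPartial (J := {i}) (a := fun _ => a) (by simp)
      (by simpa using ha) (Y := (part π i \ W).filter fun v => a ∈ L v) (fun v hv => ?_) ?_
    · obtain ⟨hv1, hv2⟩ := mem_filter.1 hv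
      obtain ⟨hv3, hv4⟩ := mem_sdiff.1 hv1
      have hvi := mem_part.1 hv3
      exact ⟨notMem_singles.2 (hvi ▸ hi), hv4, mem_singleton.2 hvi, hv2⟩
    · rw [card_singleton]
      omega
  have h2 := (sum_le_sum h1).trans hsum
  rw [sum_const, smul_eq_mul, h.card_colours hp] at h2
  have h3 := card_filter_ne_add (π := π) W i
  have h4 := card_sdiff_add_card_inter (part π i) W
  have hk := h.pos
  have h5 : (part π i \ W).card - 1 ≤ 1 := by
    by_contra hlt
    have : k * 2 ≤ k * ((part π i \ W).card - 1) := Nat.mul_le_mul_left k (by omega)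
    omega
  have h6 : (part π i \ W).card - 1 = 1 := by omega
  rw [h6] at h2
  exact ⟨card_eq_zero.1 (by omega), by omega⟩

theorem false_of_palette (h : OhbaCounterexample π L) (hp : Palette π L F d) : False := by
  obtain ⟨i₀, hi₀⟩ := h.exists_three_le
  set A := Palette.colours π F d with hAdef
  have hA : A.card = k := h.card_colours hp
  obtain ⟨W, ψ, hW⟩ := exists_maxColouring π L A i₀
  obtain ⟨i, hi, hi2, hiW⟩ := h.exists_inter_eq_empty hp hW
  have hWk := h.card_eq_of_inter_eq_empty hp hW hi hiW
  have hpair := (h.card_part_of_card_eq hp hW hWk hi hi2).2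
  have hi₀big : i₀ ∈ bigParts π := mem_bigParts.2 (by omega)
  obtain ⟨w, hw⟩ : (part π i₀ ∩ W).Nonempty := by
    rw [nonempty_iff_ne_empty]
    intro he
    have h1 := card_sdiff_add_card_inter (part π i₀) W
    rw [he, card_empty] at h1
    have := (h.card_part_of_card_eq hp hW hWk hi₀big (by omega)).2
    omega
  obtain ⟨hw₀, hwW⟩ := mem_inter.1 hw
  have hii₀ : i ≠ i₀ := fun hii => by rw [hii] at hpair; omega
  have hRsum := sum_card_filter_eq hW.isPartial i
  have hpotcard : (pot L).card = 2 * k := le_antisymm h.card_pot_le (h.two_mul_le_card_pot hpair)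
  have hR : (pot L \ A).card + A.card = (pot L).card :=
    card_sdiff_add_card_eq_card (colours_subset hp)
  have hcover : (part π i).biUnion L = pot L := eq_of_subset_of_card_le (biUnion_subset_pot _) (by
    have := h.two_mul_le_card_biUnion hpair
    omega)
  have hH : ∀ c ∈ pot L \ A, 1 ≤ ((part π i \ W).filter fun v => c ∈ L v).card := by
    intro c hc
    have hc' := (mem_sdiff.1 hc).1
    rw [← hcover] at hc'
    obtain ⟨v, hv, hcv⟩ := mem_biUnion.1 hc'
    refine card_pos.2 ⟨v, mem_filter.2 ⟨mem_sdiff.2 ⟨hv, fun hvW => ?_⟩, hcv⟩⟩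
    exact notMem_empty v (hiW ▸ mem_inter.2 ⟨hv, hvW⟩)
  have hX : ∀ c ∈ pot L \ A, 1 ≤ (W.filter fun v => ψ v = c ∧ π v ≠ i).card := fun c hc =>
    (hH c hc).trans (card_filter_le_of_max hW hi (mem_sdiff.1 hc).2)
  have hψ : ψ w ∈ pot L \ A := mem_sdiff.2
    ⟨subset_pot w (hW.isPartial.mem w hwW), hW.isPartial.notMem w hwW⟩
  have hX1 : (W.filter fun v => ψ v = ψ w ∧ π v ≠ i).card = 1 := by
    have h3 := card_filter_ne_add (π := π) W i
    rw [hiW, card_empty] at h3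
    have h4 : ∑ c ∈ pot L \ A, 1 = ∑ c ∈ pot L \ A,
        (W.filter fun v => ψ v = c ∧ π v ≠ i).card := by
      rw [hRsum, sum_const, smul_eq_mul]
      omega
    exact ((sum_eq_sum_iff_of_le hX).1 h4 _ hψ).symm
  have hwX : w ∈ W.filter fun v => ψ v = ψ w ∧ π v ≠ i :=
    mem_filter.2 ⟨hwW, rfl, fun hwi => hii₀ (hwi.symm.trans (mem_part.1 hw₀))⟩
  have hex := hW.max _ _ (exchange hW.isPartial hi (mem_sdiff.1 hψ).2)
  have hcard := card_exchange (π := π) (L := L) W ψ i (ψ w)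
  have hHle := card_filter_le_of_max hW hi (mem_sdiff.1 hψ).2
  have hHge := hH _ hψ
  set W' := (W.filter fun v => ¬(ψ v = ψ w ∧ π v ≠ i)) ∪
    (part π i \ W).filter fun v => ψ w ∈ L v with hW'
  have hWW' : W'.card = W.card := by omega
  have hlt : (part π i₀ \ W).card < (part π i₀ \ W').card := by
    refine card_lt_card ((ssubset_iff_of_subset fun v hv => ?_).2 ⟨w, mem_sdiff.2 ⟨hw₀, ?_⟩, ?_⟩)
    · obtain ⟨hv1, hv2⟩ := mem_sdiff.1 hv
      refine mem_sdiff.2 ⟨hv1, fun hvW' => ?_⟩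
      rcases mem_union.1 hvW' with hv' | hv'
      · exact hv2 (mem_filter.1 hv').1
      · have := mem_part.1 (mem_sdiff.1 (mem_filter.1 hv').1).1
        exact hii₀ (this.symm.trans (mem_part.1 hv1))
    · intro hwW'
      rcases mem_union.1 hwW' with hw' | hw'
      · exact (mem_filter.1 hw').2 (mem_filter.1 hwX).2
      · exact (mem_sdiff.1 (mem_filter.1 hw').1).2 hwW
    · exact fun hw' => (mem_sdiff.1 hw').2 hwW
  rw [hWW'] at hex
  omega

end

/-- Ohba's conjecture has no minimal counterexample. -/
theorem elim (h : OhbaCounterexample π L) : False := by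
  obtain ⟨F, d, hp⟩ := h.exists_palette
  exact h.false_of_palette hp

end OhbaCounterexample

theorem exists_surjective_refinement {V : Type*} [Fintype V] (π : V → ℕ) {k : ℕ}
    (hπ : (univ.image π).card ≤ k) (hk : k ≤ Fintype.card V) :
    ∃ ρ : V → Fin k, Function.Surjective ρ ∧ ∀ u w, ρ u = ρ w → π u = π w := by
  classical
  obtain ⟨ρ, ⟨hρ, hρk⟩, hmax⟩ := exists_maximal_of_le
    (p := fun ρ : V → ℕ => (∀ u w, ρ u = ρ w → π u = π w) ∧ (univ.image ρ).card ≤ k)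
    (m := fun ρ => (univ.image ρ).card) k ⟨π, fun _ _ => id, hπ⟩ (fun ρ hρ => hρ.2)
  have hcard : (univ.image ρ).card = k := by
    by_contra hne
    obtain ⟨u, -, w, -, huw, hρuw⟩ := exists_ne_map_eq_of_card_lt_of_maps_to
      (s := univ) (t := univ.image ρ) (f := ρ) (by rw [card_univ]; omega)
      (fun v _ => by simp)
    obtain ⟨x, hx⟩ := Infinite.exists_notMem_finset (univ.image ρ)
    have hxρ : ∀ v, ρ v ≠ x := fun v hv => hx (hv ▸ mem_image_of_mem ρ (mem_univ v))
    have himage : univ.image (Function.update ρ u x) = insert x (univ.image ρ) := by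
      ext y
      simp only [mem_insert, mem_image, mem_univ, true_and]
      constructor
      · rintro ⟨v, rfl⟩
        by_cases hv : v = u
        · exact Or.inl (by rw [hv, Function.update_self])
        · exact Or.inr ⟨v, by rw [Function.update_of_ne hv]⟩
      · rintro (rfl | ⟨v, rfl⟩)
        · exact ⟨u, Function.update_self _ _ _⟩
        · by_cases hv : v = u
          · exact ⟨w, by rw [Function.update_of_ne huw.symm, hv, hρuw]⟩
          · exact ⟨v, by rw [Function.update_of_ne hv]⟩
    have hc := card_insert_of_notMem hx
    have h1 := hmax (Function.update ρ u x) ⟨fun a b hab => ?_, by rw [himage]; omega⟩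
    · rw [himage] at h1
      omega
    · by_cases ha : a = u <;> by_cases hb : b = u
      · rw [ha, hb]
      · rw [ha, Function.update_self, Function.update_of_ne hb] at hab
        exact absurd hab.symm (hxρ b)
      · rw [hb, Function.update_self, Function.update_of_ne ha] at hab
        exact absurd hab (hxρ a)
      · rw [Function.update_of_ne ha, Function.update_of_ne hb] at hab
        exact hρ a b hab
  set e := Finset.equivFinOfCardEq hcard
  refine ⟨fun v => e ⟨ρ v, mem_image_of_mem ρ (mem_univ v)⟩, fun i => ?_, fun u w huw => ?_⟩
  · obtain ⟨v, -, hv⟩ := mem_image.1 (e.symm i).2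
    exact ⟨v, by simp [hv]⟩
  · exact hρ u w (congrArg Subtype.val (e.injective huw))

theorem exists_colouring_of_subtype {V α : Type*} {s : Finset V} {π : V → α}
    {L : V → Finset ℕ}
    (hs : ∃ g : s → ℕ, (∀ v : s, g v ∈ L v) ∧ ∀ u w : s, g u = g w → π u = π w) :
    ∃ g : V → ℕ, (∀ v ∈ s, g v ∈ L v) ∧ ∀ u ∈ s, ∀ w ∈ s, g u = g w → π u = π w := by
  classical
  obtain ⟨g, hg, hgp⟩ := hs
  refine ⟨fun v => if hv : v ∈ s then g ⟨v, hv⟩ else 0, fun v hv => ?_, fun u hu w hw huw => ?_⟩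
  · simpa [hv] using hg ⟨v, hv⟩
  · simp only [hu, hw, dite_true] at huw
    exact hgp _ _ huw

/-- **Ohba's conjecture**, the theorem of Noel, Reed and Wu: a complete `k`-partite graph with at
most `2k + 1` vertices is `k`-choosable. The parts are the fibres of `π`. -/
theorem exists_colouring_of_card_le {V : Type*} [Fintype V] (π : V → ℕ) (k : ℕ)
    (L : V → Finset ℕ) (hπ : (univ.image π).card ≤ k) (hV : Fintype.card V ≤ 2 * k + 1)
    (hL : ∀ v, k ≤ (L v).card) :
    ∃ f : V → ℕ, (∀ v, f v ∈ L v) ∧ ∀ u w, f u = f w → π u = π w := by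
  classical
  induction hn : Fintype.card V using Nat.strong_induction_on generalizing V k with
  | _ n ih =>
    subst hn
    rcases le_total (Fintype.card V) k with hk | hk
    · obtain ⟨f, hf, hfL⟩ := exists_injOn_of_card_le univ L fun v _ => by
        rw [card_univ]
        exact hk.trans (hL v)
      exact ⟨f, fun v => hfL v (mem_univ v), fun u w huw => by
        rw [hf (mem_coe.2 (mem_univ u)) (mem_coe.2 (mem_univ w)) huw]⟩
    · obtain ⟨ρ, hρ, hρπ⟩ := exists_surjective_refinement π hπ hk
      by_contra! hno
      refine OhbaCounterexample.elim (π := ρ) (L := L) ⟨hρ, hV, hL, fun f hf hfp => ?_, ?_⟩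
      · obtain ⟨u, w, huw, hne⟩ := hno f hf
        exact hne (hρπ u w (hfp u w huw))
      · intro Q L' k' hQ hQk hQcard hL'
        apply exists_colouring_of_subtype
        obtain ⟨g, hg, hgp⟩ := ih (Fintype.card Q)
          (by
            rw [Fintype.card_coe, ← card_univ]
            exact card_lt_card (ssubset_univ_iff.2 hQ))
          (fun v : Q => (ρ v : ℕ)) k' (fun v => L' v)
          (by
            have h1 : univ.image (fun v : Q => (ρ v : ℕ)) ⊆ (Q.image ρ).image Fin.val := by
              intro x hx
              obtain ⟨v, -, rfl⟩ := mem_image.1 hx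
              exact mem_image_of_mem _ (mem_image_of_mem _ v.2)
            exact (card_le_card h1).trans (card_image_le.trans hQk))
          (by simpa using hQcard) (fun v => hL' v v.2) rfl
        exact ⟨g, hg, fun u w huw => Fin.ext (hgp u w huw)⟩

theorem exists_colouring_on_of_card_le {V : Type*} (s : Finset V) (π : V → ℕ) (k : ℕ)
    (L : V → Finset ℕ) (hπ : (s.image π).card ≤ k) (hs : s.card ≤ 2 * k + 1)
    (hL : ∀ v ∈ s, k ≤ (L v).card) :
    ∃ f : V → ℕ, (∀ v ∈ s, f v ∈ L v) ∧ ∀ u ∈ s, ∀ w ∈ s, f u = f w → π u = π w := by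
  apply exists_colouring_of_subtype
  refine exists_colouring_of_card_le (fun v : s => π v) k (fun v => L v) ?_ (by simpa using hs)
    (fun v => hL v v.2)
  refine (card_le_card fun x hx => ?_).trans hπ
  obtain ⟨v, -, rfl⟩ := mem_image.1 hx
  exact mem_image_of_mem _ v.2

theorem exists_colouring_union_of_card_le {V ι : Type*} [DecidableEq ι] (π : V → ℕ)
    (T : ι → V → Finset ℕ) (B : V → Finset ℕ) (O : Finset ι)
    (hTT : ∀ i ∈ O, ∀ j ∈ O, i ≠ j → ∀ u w, Disjoint (T i u) (T j w))
    (hTB : ∀ i ∈ O, ∀ u w, Disjoint (T i u) (B w)) (s : Finset V) (k : ℕ)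
    (hT : ∀ i ∈ O, ∀ v ∈ s, (T i v).Nonempty) (hB : ∀ v ∈ s, k ≤ (B v).card + O.card)
    (hπ : (s.image π).card ≤ k) (hs : s.card ≤ 2 * k + 1) :
    ∃ f : V → ℕ, (∀ v ∈ s, f v ∈ B v ∪ O.biUnion fun i => T i v) ∧
      ∀ u ∈ s, ∀ w ∈ s, f u = f w → π u = π w := by
  refine exists_colouring_on_of_card_le s π k _ hπ hs fun v hv => ?_
  rw [card_union_of_disjoint, card_biUnion fun i hi j hj hij => hTT i hi j hj hij v v]
  · have h1 : ∑ i ∈ O, 1 ≤ ∑ i ∈ O, (T i v).card :=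
      sum_le_sum fun i hi => card_pos.2 (hT i hi v hv)
    have h2 := hB v hv
    rw [sum_const, smul_eq_mul, mul_one] at h1
    omega
  · rw [disjoint_biUnion_right]
    exact fun i hi => (hTB i hi v v).symm

/-- Each additional private set of colours allows for one more vertex than in Ohba's conjecture. -/
theorem exists_colouring_of_card_le_add {V ι : Type*} [DecidableEq ι] (π : V → ℕ)
    (T : ι → V → Finset ℕ) (B : V → Finset ℕ) (O : Finset ι)
    (hTT : ∀ i ∈ O, ∀ j ∈ O, i ≠ j → ∀ u w, Disjoint (T i u) (T j w))
    (hTB : ∀ i ∈ O, ∀ u w, Disjoint (T i u) (B w)) (s : Finset V) (k : ℕ)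
    (hT : ∀ i ∈ O, ∀ v ∈ s, (T i v).Nonempty) (hB : ∀ v ∈ s, k ≤ (B v).card + O.card)
    (hπ : (s.image π).card ≤ k) (hs : s.card ≤ 2 * k + O.card + 1) :
    ∃ f : V → ℕ, (∀ v ∈ s, f v ∈ B v ∪ O.biUnion fun i => T i v) ∧
      ∀ u ∈ s, ∀ w ∈ s, f u = f w → π u = π w := by
  classical
  induction O using Finset.induction_on generalizing s k with
  | empty => exact exists_colouring_union_of_card_le π T B ∅ hTT hTB s k hT hB hπ (by simpa using hs)
  | insert o O ho ih =>
    by_cases hsmall : s.card ≤ 2 * k + 1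
    · exact exists_colouring_union_of_card_le π T B _ hTT hTB s k hT hB hπ hsmall
    rw [card_insert_of_notMem ho] at hs hB
    obtain ⟨x, hx⟩ : ∃ x, 3 ≤ (s.filter fun v => π v = x).card := by
      by_contra! hall
      have h1 := card_le_mul_card_image (f := π) s 2
        (fun x _ => Nat.le_of_lt_succ (hall x))
      omega
    have hsplit : (s.filter fun v => π v = x).card + (s.filter fun v => π v ≠ x).card = s.card :=
      card_filter_add_card_filter_not _
    obtain ⟨v₀, hv₀⟩ := card_pos.1 (by omega : 0 < (s.filter fun v => π v = x).card)
    have hximage : x ∈ s.image π :=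
      mem_image.2 ⟨v₀, (mem_filter.1 hv₀).1, (mem_filter.1 hv₀).2⟩
    have hkpos : 0 < (s.image π).card := card_pos.2 ⟨x, hximage⟩
    have hOo : ∀ i ∈ O, i ∈ insert o O := fun i hi => mem_insert_of_mem hi
    obtain ⟨g, hg, hgp⟩ := ih (fun i hi j hj => hTT i (hOo i hi) j (hOo j hj))
      (fun i hi => hTB i (hOo i hi)) (s.filter fun v => π v ≠ x) (k - 1)
      (fun i hi v hv => hT i (hOo i hi) v (mem_filter.1 hv).1)
      (fun v hv => by
        have := hB v (mem_filter.1 hv).1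
        omega)
      (by
        have h1 : (s.filter fun v => π v ≠ x).image π ⊆ (s.image π).erase x := by
          intro y hy
          obtain ⟨v, hv, rfl⟩ := mem_image.1 hy
          exact mem_erase.2 ⟨(mem_filter.1 hv).2, mem_image_of_mem π (mem_filter.1 hv).1⟩
        have h2 := card_le_card h1
        rw [card_erase_of_mem hximage] at h2
        omega)
      (by omega)
    choose! τ hτ using hT o (mem_insert_self o O)
    have hg' : ∀ v ∈ s, π v ≠ x → ∀ w, g v ∉ T o w := by
      intro v hv hvx w hgw
      rcases mem_union.1 (hg v (mem_filter.2 ⟨hv, hvx⟩)) with h1 | h1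
      · exact Finset.disjoint_left.1 (hTB o (mem_insert_self o O) w v) hgw h1
      · obtain ⟨i, hi, h1⟩ := mem_biUnion.1 h1
        exact Finset.disjoint_left.1 (hTT o (mem_insert_self o O) i (hOo i hi)
          (fun hoi => ho (hoi ▸ hi)) w v) hgw h1
    refine ⟨fun v => if π v = x then τ v else g v, fun v hv => ?_, fun u hu w hw huw => ?_⟩
    · by_cases hvx : π v = x
      · simp only [hvx, if_true]
        exact mem_union_right _ (mem_biUnion.2 ⟨o, mem_insert_self o O, hτ v hv⟩)
      · simp only [hvx, if_false]
        refine union_subset_union subset_rfl ?_ (hg v (mem_filter.2 ⟨hv, hvx⟩))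
        exact biUnion_subset_biUnion_of_subset_left _ (subset_insert o O)
    · by_cases hux : π u = x <;> by_cases hwx : π w = x <;>
        simp only [hux, hwx, if_true, if_false] at huw
      · rw [hux, hwx]
      · exact absurd (huw ▸ hτ u hu) (hg' w hw hwx u)
      · exact absurd (huw ▸ hτ w hw) (hg' u hu hux w)
      · exact hgp u (mem_filter.2 ⟨hu, hux⟩) w (mem_filter.2 ⟨hw, hwx⟩) huw

theorem card_filter_get_eq_one (l : List ℕ) :
    (univ.filter fun i : Fin l.length => l.get i = 1).card = l.count 1 := by
  have h1 : ∀ l : List ℕ, (l.map fun x => if x = 1 then 1 else 0).sum = l.count 1 := by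
    intro l
    induction l with
    | nil => simp
    | cons a l ih => simp [List.count_cons, ih, add_comm]
  rw [card_filter, ← h1 l, ← Fin.sum_univ_fun_getElem]
  rfl

end Ohba

theorem chromatic_small_graph_choosable {V : Type*} [Fintype V] (G : SimpleGraph V)
    (lam : Multiset ℕ) (hpos : ∀ x ∈ lam, 0 < x)
    (hchr : G.chromaticNumber = (lam.sum : ℕ∞))
    (hcard : Fintype.card V ≤ 2 * lam.sum + lam.count 1 + 1) :
    LamChoosable G lam := by
  rintro L ⟨l, C, rfl, hC, hL⟩
  obtain ⟨col⟩ := chromaticNumber_le_iff_colorable.1 hchr.le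
  rw [Multiset.sum_coe] at col hcard
  rw [Multiset.coe_count, ← Ohba.card_filter_get_eq_one] at hcard
  set O := Finset.univ.filter fun i : Fin l.length => l.get i = 1 with hO
  have hdisj : ∀ i j, i ≠ j → ∀ u w, Disjoint (L u ∩ C i) (L w ∩ C j) := fun i j hij u w =>
    (hC i j hij).mono Finset.inter_subset_right Finset.inter_subset_right
  obtain ⟨f, hf, hfp⟩ := Ohba.exists_colouring_of_card_le_add (fun v => (col v : ℕ))
    (fun i v => L v ∩ C i) (fun v => Oᶜ.biUnion fun i => L v ∩ C i) O
    (fun i _ j _ hij => hdisj i j hij)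
    (fun i hi u w => by
      rw [Finset.disjoint_biUnion_right]
      exact fun j hj => hdisj i j (fun hij => Finset.mem_compl.1 hj (hij ▸ hi)) u w)
    Finset.univ l.sum
    (fun i hi v _ => by
      have h1 := hL v i
      rw [(Finset.mem_filter.1 hi).2] at h1
      exact Finset.card_pos.1 h1)
    (fun v _ => by
      rw [Finset.card_biUnion fun i _ j _ hij => hdisj i j hij v v]
      have h1 : l.sum = ∑ i, l.get i := (Fin.sum_univ_getElem l).symm
      have h2 : ∑ i ∈ O, l.get i = O.card := by
        rw [Finset.card_eq_sum_ones]
        exact Finset.sum_congr rfl fun i hi => (Finset.mem_filter.1 hi).2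
      rw [h1, ← Finset.sum_compl_add_sum O, h2]
      exact Nat.add_le_add_right (Finset.sum_le_sum fun i _ => hL v i) _)
    (by
      refine (Finset.card_le_card (t := Finset.range l.sum) fun x hx => ?_).trans_eq
        (Finset.card_range _)
      obtain ⟨v, -, rfl⟩ := Finset.mem_image.1 hx
      exact Finset.mem_range.2 (col v).2)
    hcard
  refine ⟨f, fun v => ?_, fun u w huw hfuw => ?_⟩
  · rcases Finset.mem_union.1 (hf v (Finset.mem_univ v)) with h1 | h1 <;>
    · obtain ⟨i, -, hi⟩ := Finset.mem_biUnion.1 h1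
      exact (Finset.mem_inter.1 hi).1
  · exact col.valid huw (Fin.ext (hfp u (Finset.mem_univ u) w (Finset.mem_univ w) hfuw))
end

section
/- Let λ be a non-trivial multiset of positive integers (i.e. |λ| < k_λ) with sum k_λ, and let o_λ be the number of odd elements of λ counted with multiplicity. Then there exists a finite simple graph G with chromatic number equal to k_λ and exactly 2k_λ + o_λ + 2 vertices which is not λ-choosable. -/
open SimpleGraph

theorem LamChoosable.of_iso {V W : Type*} {G : SimpleGraph V} {H : SimpleGraph W}
    {lam : Multiset ℕ} (e : G ≃g H) (h : LamChoosable G lam) : LamChoosable H lam := by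
  rintro L ⟨l, C, hl, hC, hLC⟩
  obtain ⟨f, hfL, hf⟩ := h (fun v => L (e v)) ⟨l, C, hl, hC, fun v i => hLC (e v) i⟩
  refine ⟨fun w => f (e.symm w), fun w => ?_, fun u w huw => hf (e.symm.map_adj_iff.2 huw)⟩
  simpa using hfL (e.symm w)

/-- Disjoint images of the parts bound the number of colours of a proper colouring of a complete
multipartite graph from below. -/
theorem sum_le_card_of_completeMultipartiteGraph_coloring {ι Γ : Type*} [Fintype ι] [Fintype Γ]
    [DecidableEq Γ] {V : ι → Type*} [∀ p, Fintype (V p)] (w : ι → ℕ)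
    (f : (completeMultipartiteGraph V).Coloring Γ)
    (hw : ∀ p, w p ≤ (Finset.univ.image fun j : V p => f ⟨p, j⟩).card) :
    ∑ p, w p ≤ Fintype.card Γ := by
  classical
  calc ∑ p, w p ≤ ∑ p, (Finset.univ.image fun j : V p => f ⟨p, j⟩).card :=
        Finset.sum_le_sum fun p _ => hw p
    _ = (Finset.univ.biUnion fun p => Finset.univ.image fun j : V p => f ⟨p, j⟩).card := by
        refine (Finset.card_biUnion fun p _ q _ hpq => ?_).symm
        refine Finset.disjoint_left.2 ?_
        intro c hp hq
        simp only [Finset.mem_image, Finset.mem_univ, true_and] at hp hq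
        obtain ⟨j, rfl⟩ := hp
        obtain ⟨j', hj'⟩ := hq
        exact f.valid (v := ⟨q, j'⟩) (w := ⟨p, j⟩) (by simpa using hpq.symm) hj'
    _ ≤ Fintype.card Γ := Finset.card_le_univ _

theorem Multiset.sum_eq_two_mul_sum_half_add_card_odd (s : Multiset ℕ) :
    s.sum = 2 * (s.map (· / 2)).sum + Multiset.card (s.filter fun x => Odd x) := by
  induction s using Multiset.induction with
  | empty => simp
  | cons k s ih =>
    by_cases hk : Odd k
    · have := Nat.odd_iff.1 hk
      simp [hk]
      omega
    · have := Nat.not_odd_iff.1 hk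
      simp [hk]
      omega

/-- The sizes of three classes, any two of which contain at least `k` elements together. -/
def classSize (k : ℕ) : Fin 3 → ℕ := ![(k + 1) / 2, (k + 1) / 2, k / 2]

theorem Multiset.sum_classSize (s : Multiset ℕ) :
    (s.map fun k => ∑ t, classSize k t).sum =
      3 * (s.map (· / 2)).sum + 2 * Multiset.card (s.filter fun x => Odd x) := by
  induction s using Multiset.induction with
  | empty => simp
  | cons k s ih =>
    by_cases hk : Odd k
    · have := Nat.odd_iff.1 hk
      simp only [Multiset.map_cons, Multiset.sum_cons, hk, Multiset.filter_cons_of_pos,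
        Multiset.card_cons, classSize, Fin.sum_univ_three, Matrix.cons_val] at ih ⊢
      omega
    · have := Nat.not_odd_iff.1 hk
      simp only [Multiset.map_cons, Multiset.sum_cons, hk, not_false_eq_true,
        Multiset.filter_cons_of_neg, classSize, Fin.sum_univ_three, Matrix.cons_val] at ih ⊢
      omega

/-- Colours: each entry of `l` contributes three classes of sizes given by `classSize`. -/
abbrev ClassColour (l : List ℕ) : Type :=
  Σ i : Fin l.length, Σ t : Fin 3, Fin (classSize (l.get i) t)

theorem card_classColour (l : List ℕ) :
    Fintype.card (ClassColour l) = 3 * (l.map (· / 2)).sum +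
      2 * Multiset.card ((l : Multiset ℕ).filter fun x => Odd x) := by
  have h := Multiset.sum_classSize (l : Multiset ℕ)
  simp only [Multiset.map_coe, Multiset.sum_coe] at h
  rw [← h, Fintype.card_sigma]
  simp only [Fintype.card_sigma, Fintype.card_fin]
  rw [← Fin.sum_univ_fun_getElem l fun k => ∑ t, classSize k t]
  rfl

theorem le_card_classColour_filter (l : List ℕ) (i : Fin l.length) (t : Fin 3) :
    l.get i ≤ (Finset.univ.filter fun c : ClassColour l => c.1 = i ∧ c.2.1 ≠ t).card := by
  have hsub : ((Finset.univ.erase t).sigma fun s =>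
      (Finset.univ : Finset (Fin (classSize (l.get i) s)))).map
        (Function.Embedding.sigmaMk (β := fun i => Σ t : Fin 3, Fin (classSize (l.get i) t)) i) ⊆
      Finset.univ.filter fun c : ClassColour l => c.1 = i ∧ c.2.1 ≠ t := by
    intro c hc
    simp only [Finset.mem_map, Finset.mem_sigma, Finset.mem_erase] at hc
    obtain ⟨x, hx, rfl⟩ := hc
    simpa using hx.1.1
  refine le_trans ?_ (Finset.card_le_card hsub)
  rw [Finset.card_map, Finset.card_sigma]
  simp only [Finset.card_univ, Fintype.card_fin]
  have h := Finset.add_sum_erase Finset.univ (classSize (l.get i)) (Finset.mem_univ t)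
  rw [Fin.sum_univ_three] at h
  fin_cases t <;> simp [classSize] at h ⊢ <;> omega

/-- The part sizes of the complete multipartite graph `K_{3 * a, 1 * b}`. -/
abbrev partSize (a b : ℕ) : Fin a ⊕ Fin b → ℕ := Sum.elim (fun _ => 3) fun _ => 1

theorem not_lamChoosable_completeMultipartiteGraph (l : List ℕ) (a b : ℕ)
    (hab : Fintype.card (ClassColour l) < 2 * a + b) :
    ¬ LamChoosable (completeMultipartiteGraph fun p => Fin (partSize a b p)) (l : Multiset ℕ) := by
  intro hch
  let e : ClassColour l ↪ ℕ := (Fintype.equivFin _).toEmbedding.trans Fin.valEmbedding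
  let cls : (Σ p, Fin (partSize a b p)) → Fin 3 := fun v => Fin.ofNat 3 v.2
  let L : (Σ p, Fin (partSize a b p)) → Finset ℕ := fun v =>
    (Finset.univ.filter fun c : ClassColour l => c.2.1 ≠ cls v).map e
  have hL : IsLamAssignment (l : Multiset ℕ) L := by
    refine ⟨l, fun i => (Finset.univ.filter fun c : ClassColour l => c.1 = i).map e, rfl, ?_, ?_⟩
    · intro i j hij
      rw [Finset.disjoint_map, Finset.disjoint_filter]
      rintro c - rfl
      exact hij
    · intro v i
      rw [← Finset.map_inter, Finset.card_map, ← Finset.filter_and]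
      simpa only [and_comm] using le_card_classColour_filter l i (cls v)
  obtain ⟨f, hfL, hf⟩ := hch L hL
  simp only [L, Finset.mem_map, Finset.mem_filter, Finset.mem_univ, true_and] at hfL
  choose g hg hgf using hfL
  let col : (completeMultipartiteGraph fun p => Fin (partSize a b p)).Coloring (ClassColour l) :=
    Coloring.mk g fun {u w} huw h => hf huw (by rw [← hgf u, ← hgf w, h])
  have := sum_le_card_of_completeMultipartiteGraph_coloring
    (Sum.elim (fun _ => 2) fun _ => 1) col ?_
  · simp at this
    simp at hab
    omega
  rintro (p | p)
  · change 1 < _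
    let j (t : Fin 3) : Fin (partSize a b (Sum.inl p)) := t
    let t := (g ⟨Sum.inl p, j 0⟩).2.1
    refine Finset.one_lt_card.2 ⟨g ⟨Sum.inl p, j 0⟩, Finset.mem_image_of_mem _ (Finset.mem_univ _),
      g ⟨Sum.inl p, j t⟩, Finset.mem_image_of_mem _ (Finset.mem_univ _), fun h => ?_⟩
    refine hg ⟨Sum.inl p, j t⟩ ?_
    rw [← h]
    exact Fin.ext (Nat.mod_eq_of_lt t.isLt).symm
  · exact Finset.card_pos.2 ⟨g ⟨Sum.inr p, (0 : Fin 1)⟩,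
      Finset.mem_image_of_mem _ (Finset.mem_univ _)⟩

theorem exists_non_choosable_graph_upper (lam : Multiset ℕ)
    (hpos : ∀ x ∈ lam, 0 < x) (hnt : Multiset.card lam < lam.sum) :
    ∃ G : SimpleGraph
        (Fin (2 * lam.sum + Multiset.card (lam.filter (fun x => Odd x)) + 2)),
      G.chromaticNumber = (lam.sum : ℕ∞) ∧ ¬ LamChoosable G lam := by
  obtain ⟨l, rfl⟩ := Quot.exists_rep lam
  change Multiset.card (l : Multiset ℕ) < (l : Multiset ℕ).sum at hnt
  have hsum := Multiset.sum_eq_two_mul_sum_half_add_card_odd (l : Multiset ℕ)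
  have hodd := Multiset.card_le_card (Multiset.filter_le (fun x => Odd x) (l : Multiset ℕ))
  have hcol := card_classColour l
  change ∃ G : SimpleGraph (Fin (2 * (l : Multiset ℕ).sum +
    Multiset.card ((l : Multiset ℕ).filter (fun x => Odd x)) + 2)),
      G.chromaticNumber = ((l : Multiset ℕ).sum : ℕ∞) ∧ ¬ LamChoosable G (l : Multiset ℕ)
  rw [Multiset.map_coe, Multiset.sum_coe (l.map _)] at hsum
  generalize (l.map (· / 2)).sum = h at *
  generalize Multiset.card ((l : Multiset ℕ).filter fun x => Odd x) = o at *
  generalize (l : Multiset ℕ).sum = k at *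
  have hcard : Fintype.card (Σ p, Fin (partSize (h + o + 1) (h - 1) p)) = 2 * k + o + 2 := by
    simp [Fintype.card_sigma]
    omega
  let K := completeMultipartiteGraph fun p => Fin (partSize (h + o + 1) (h - 1) p)
  have iso : K ≃g K.overFin hcard := K.overFinIso hcard
  refine ⟨K.overFin hcard, ?_, fun hch => ?_⟩
  · have : ∀ p, Nonempty (Fin (partSize (h + o + 1) (h - 1) p)) := by
      rintro (p | p) <;> exact ⟨(0 : Fin (_ + 1))⟩
    rw [← chromaticNumber_congr iso,
      completeMultipartiteGraph.chromaticNumber _ fun p => (this p).some]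
    simp only [Fintype.card_sum, Fintype.card_fin]
    congr 1
    omega
  · exact not_lamChoosable_completeMultipartiteGraph l (h + o + 1) (h - 1) (by omega)
       (hch.of_iso iso.symm)
end
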